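/- arXiv:1701.02400 — 4 statements merged into one kernel-verified Lean document; each statement's English description precedes it below -/
import Mathlib

section
/- A probability distribution μ on ℝ is quasi-infinitely divisible (i.e., its characteristic function equals exp(iγz + ∫ g_c(x,z) ζ(dx)) for some γ ∈ ℝ and finite signed measure ζ) if and only if there exist two infinitely divisible distributions μ₁ and μ₂ on ℝ such that μ̂₁(z) = μ̂(z)·μ̂₂(z) for all z ∈ ℝ. -/
open MeasureTheory Complex Filter

noncomputable section

/-- Characteristic function of a measure on ℝ. -/
def charFn (μ : Measure ℝ) (z : ℝ) : ℂ := ∫ x, Complex.exp (Complex.I * z * x) ∂μ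

/-- A representation function: bounded, Borel measurable, with (c x - x)/x² → 0 as x → 0. -/
def IsRepFn (c : ℝ → ℝ) : Prop :=
  Measurable c ∧ (∃ M : ℝ, ∀ x, |c x| ≤ M) ∧
    Tendsto (fun x => (c x - x) / x ^ 2) (nhdsWithin 0 {(0:ℝ)}ᶜ) (nhds 0)

/-- The kernel g_c(x,z). -/
def gKer (c : ℝ → ℝ) (x z : ℝ) : ℂ :=
  if x = 0 then -(z:ℂ)^2 / 2
  else (Complex.exp (Complex.I * z * x) - 1 - Complex.I * z * c x) / ((min 1 (x^2) : ℝ) : ℂ)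

/-- Quasi-infinitely divisible w.r.t. c: the characteristic function has a
Lévy–Khintchine type representation with a finite signed measure ζ = ζp - ζm
(given by its Jordan decomposition). -/
def IsQID (c : ℝ → ℝ) (μ : Measure ℝ) : Prop :=
  ∃ γ : ℝ, ∃ ζp ζm : Measure ℝ, IsFiniteMeasure ζp ∧ IsFiniteMeasure ζm ∧
    Measure.MutuallySingular ζp ζm ∧
    ∀ z : ℝ, charFn μ z =
      Complex.exp (Complex.I * γ * z + (∫ x, gKer c x z ∂ζp) - ∫ x, gKer c x z ∂ζm)

/-- Infinitely divisible w.r.t. c: as above with a (positive) finite measure ζ. -/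
def IsID (c : ℝ → ℝ) (μ : Measure ℝ) : Prop :=
  ∃ γ : ℝ, ∃ ζ : Measure ℝ, IsFiniteMeasure ζ ∧
    ∀ z : ℝ, charFn μ z = Complex.exp (Complex.I * γ * z + ∫ x, gKer c x z ∂ζ)

/-- The Lévy–Khintchine integral ∫ (e^{izx} - 1 - izc(x)) dν. -/
def lkInt (c : ℝ → ℝ) (ν : Measure ℝ) (z : ℝ) : ℂ :=
  ∫ x, (Complex.exp (Complex.I * z * x) - 1 - Complex.I * z * c x) ∂ν

/-- μ has characteristic triplet (a, ν, γ) w.r.t. c, where the quasi-Lévy measure ν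
is given by its Jordan decomposition ν = νp - νm. -/
def HasTriplet (c : ℝ → ℝ) (μ : Measure ℝ) (a : ℝ) (νp νm : Measure ℝ) (γ : ℝ) : Prop :=
  Measure.MutuallySingular νp νm ∧ νp {0} = 0 ∧ νm {0} = 0 ∧
  (∫⁻ x, ENNReal.ofReal (min 1 (x^2)) ∂(νp + νm)) < ⊤ ∧
  ∀ z : ℝ, charFn μ z =
    Complex.exp (Complex.I * γ * z - a * z^2 / 2 + lkInt c νp z - lkInt c νm z)

open scoped Topology

lemma charFn_eq_charFun (μ : Measure ℝ) (z : ℝ) : charFn μ z = charFun μ z := by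
  rw [charFn, charFun_apply_real]
  congr with x
  ring_nf

/-- The functions that are characteristic functions of probability measures. -/
def IsCharFun (φ : ℝ → ℂ) : Prop :=
  ∃ μ : Measure ℝ, IsProbabilityMeasure μ ∧ ∀ z, charFun μ z = φ z

namespace IsCharFun

variable {φ ψ : ℝ → ℂ}

lemma one : IsCharFun fun _ ↦ 1 :=
  ⟨Measure.dirac 0, inferInstance, fun z ↦ by simp [charFun_dirac]⟩

lemma mul (hφ : IsCharFun φ) (hψ : IsCharFun ψ) : IsCharFun fun z ↦ φ z * ψ z := by
  obtain ⟨μ, hμ, hφ⟩ := hφ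
  obtain ⟨ν, hν, hψ⟩ := hψ
  exact ⟨μ.conv ν, inferInstance, fun z ↦ by rw [charFun_conv, hφ, hψ]⟩

lemma pow (hφ : IsCharFun φ) (n : ℕ) : IsCharFun fun z ↦ φ z ^ n := by
  induction n with
  | zero => simpa using one
  | succ n ih => simpa only [pow_succ] using ih.mul hφ

/-- A pointwise limit of characteristic functions that is continuous at `0` is a characteristic
function. -/
lemma of_tendsto {f : ℕ → ℝ → ℂ} (hf : ∀ n, IsCharFun (f n)) (hφ : ContinuousAt φ 0)
    (h : ∀ z, Tendsto (fun n ↦ f n z) atTop (𝓝 (φ z))) : IsCharFun φ := by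
  choose μ hμ hμf using hf
  let P : ℕ → ProbabilityMeasure ℝ := fun n ↦ ⟨μ n, hμ n⟩
  have htight : IsTightMeasureSet (Set.range μ) :=
    isTightMeasureSet_of_tendsto_charFun hφ fun z ↦ by simpa only [hμf] using h z
  have hcomp : IsCompact (closure (Set.range P)) := by
    apply isCompact_closure_of_isTightMeasureSet
    convert htight
    ext ν
    exact Set.exists_range_iff
  obtain ⟨Q, -, k, hk, hQ⟩ := hcomp.tendsto_subseq fun n ↦ subset_closure (Set.mem_range_self n)
  refine ⟨Q, inferInstance, fun z ↦ ?_⟩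
  refine tendsto_nhds_unique (ProbabilityMeasure.tendsto_iff_tendsto_charFun.1 hQ z) ?_
  exact ((h z).comp hk.tendsto_atTop).congr fun n ↦ (hμf (k n) z).symm

lemma gaussian (γ : ℝ) {a : ℝ} (ha : 0 ≤ a) :
    IsCharFun fun z ↦ Complex.exp (I * γ * z - a * z ^ 2 / 2) := by
  refine ⟨ProbabilityTheory.gaussianReal γ (.mk a ha), inferInstance, fun z ↦ ?_⟩
  rw [ProbabilityTheory.charFun_gaussianReal]
  congr 1
  simp only [NNReal.coe_mk]
  ring

/-- The characteristic function of the compound Poisson distribution with Lévy measure `ν`. -/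
lemma compoundPoisson (ν : Measure ℝ) [IsFiniteMeasure ν] :
    IsCharFun fun z ↦ Complex.exp (charFun ν z - ν.real Set.univ) := by
  set r : ℝ := ν.real Set.univ with hr
  have hr0 : 0 ≤ r := measureReal_nonneg
  let N : ℕ := ⌈r⌉₊ + 1
  refine of_tendsto (f := fun n z ↦ (1 + (charFun ν z - r) / ((n + N : ℕ) : ℂ)) ^ (n + N))
    (fun n ↦ pow ?_ _) ?_ fun z ↦ ?_
  · set m : ℝ := ((n + N : ℕ) : ℝ) with hm
    have hrm : r ≤ m := by
      have := Nat.le_ceil r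
      have : (0 : ℝ) ≤ n := n.cast_nonneg
      simp only [hm, N]
      push_cast
      linarith
    have hm0 : 0 < m := by
      simp only [hm, N]
      positivity
    have h1 : 0 ≤ 1 - r / m := sub_nonneg.2 ((div_le_one hm0).2 hrm)
    refine ⟨ENNReal.ofReal (1 - r / m) • Measure.dirac 0 + ENNReal.ofReal (1 / m) • ν, ⟨?_⟩,
      fun z ↦ ?_⟩
    · have : ν Set.univ = ENNReal.ofReal r := by simp [hr]
      simp only [Measure.coe_add, Measure.coe_smul, Pi.add_apply, Pi.smul_apply, smul_eq_mul,
        measure_univ, mul_one, this]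
      rw [← ENNReal.ofReal_mul (by positivity), ← ENNReal.ofReal_add h1 (by positivity),
        ← ENNReal.ofReal_one]
      congr 1
      ring
    · have hint (ρ : Measure ℝ) [IsFiniteMeasure ρ] :
          Integrable (fun x : ℝ ↦ Complex.exp (z * x * I)) ρ := by
        refine Integrable.of_bound (by fun_prop) 1 (ae_of_all _ fun x ↦ ?_)
        rw [← ofReal_mul, norm_exp_ofReal_mul_I]
      rw [charFun_apply_real, integral_add_measure
        ((hint _).smul_measure ENNReal.ofReal_ne_top) ((hint _).smul_measure ENNReal.ofReal_ne_top),
        integral_smul_measure, integral_smul_measure, ← charFun_apply_real, ← charFun_apply_real,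
        ENNReal.toReal_ofReal h1, ENNReal.toReal_ofReal (by positivity), charFun_dirac]
      have hmC : ((n + N : ℕ) : ℂ) = (m : ℂ) := by simp [hm]
      rw [hmC]
      simp only [inner_zero_left, ofReal_zero, zero_mul, Complex.exp_zero, real_smul]
      push_cast
      ring
  · exact (by fun_prop : Continuous fun z ↦ Complex.exp (charFun ν z - r)).continuousAt
  · exact (tendsto_one_add_div_pow_exp (charFun ν z - r)).comp (tendsto_add_atTop_nat N)

end IsCharFun

lemma continuous_gKer (c : ℝ → ℝ) (x : ℝ) : Continuous (gKer c x) := by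
  unfold gKer
  split_ifs <;> fun_prop

namespace IsRepFn

variable {c : ℝ → ℝ}

lemma measurable_gKer (hc : IsRepFn c) (z : ℝ) : Measurable (gKer c · z) := by
  have := hc.1
  unfold gKer
  exact Measurable.ite (measurableSet_singleton 0) measurable_const (by fun_prop)

lemma norm_gKer_le (hc : IsRepFn c) {R : ℝ} (hR : 0 ≤ R) :
    ∃ C, ∀ z, |z| ≤ R → ∀ x, ‖gKer c x z‖ ≤ C := by
  obtain ⟨-, ⟨M, hM⟩, hlim⟩ := hc
  have hM0 : 0 ≤ M := (abs_nonneg _).trans (hM 0)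
  obtain ⟨ε, hε, hball⟩ := Metric.mem_nhdsWithin_iff.1 (hlim (Metric.ball_mem_nhds 0 one_pos))
  obtain ⟨δ, hδ, hδε, hδR⟩ : ∃ δ : ℝ, 0 < δ ∧ δ ≤ ε ∧ δ ≤ 1 / (R + 1) :=
    ⟨min ε (1 / (R + 1)), by positivity, min_le_left _ _, min_le_right _ _⟩
  have hR1 : 0 < R + 1 := by positivity
  have hδ1 : δ ≤ 1 := hδR.trans ((div_le_one hR1).2 (by linarith))
  refine ⟨R ^ 2 + R + (2 + R * M) / δ ^ 2, fun z hz x ↦ ?_⟩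
  have hz2 : |z| ^ 2 ≤ R ^ 2 := by gcongr
  have hquot : 0 ≤ (2 + R * M) / δ ^ 2 := by positivity
  rw [gKer]
  split_ifs with hx
  · have : ‖-(z : ℂ) ^ 2 / 2‖ = |z| ^ 2 / 2 := by simp
    rw [this]
    nlinarith
  have hx0 : 0 < |x| := abs_pos.2 hx
  have hmin : 0 < min 1 (x ^ 2) := lt_min one_pos (by positivity)
  rw [norm_div, norm_real, Real.norm_of_nonneg hmin.le, div_le_iff₀ hmin]
  rcases lt_or_ge |x| δ with hxδ | hxδ
  · have hxx : x ^ 2 ≤ 1 := by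
      rw [← sq_abs]
      exact pow_le_one₀ hx0.le (hxδ.le.trans hδ1)
    rw [min_eq_right hxx]
    have hcx : |c x - x| ≤ x ^ 2 := by
      have h : x ∈ Metric.ball (0 : ℝ) ε ∩ {0}ᶜ := ⟨by simpa using hxδ.trans_le hδε, hx⟩
      have := hball h
      simp only [Set.mem_preimage, Metric.mem_ball, dist_zero_right, Real.norm_eq_abs, abs_div,
        abs_of_nonneg (sq_nonneg x)] at this
      exact ((div_lt_one (by positivity)).1 this).le
    have hzx : ‖I * z * x‖ = |z| * |x| := by simp
    have hsmall : ‖I * z * x‖ ≤ 1 := by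
      rw [hzx]
      calc |z| * |x| ≤ R * (1 / (R + 1)) := by gcongr; exact hxδ.le.trans hδR
        _ ≤ 1 := by rw [mul_one_div, div_le_one hR1]; linarith
    calc ‖Complex.exp (I * z * x) - 1 - I * z * c x‖
        = ‖(Complex.exp (I * z * x) - 1 - I * z * x) - I * z * ((c x - x : ℝ) : ℂ)‖ := by
          push_cast; ring_nf
      _ ≤ ‖I * z * x‖ ^ 2 + ‖I * z * ((c x - x : ℝ) : ℂ)‖ :=
          (norm_sub_le _ _).trans (by gcongr; exact norm_exp_sub_one_sub_id_le hsmall)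
      _ = |z| ^ 2 * x ^ 2 + |z| * |c x - x| := by
          rw [hzx, mul_pow, sq_abs x, norm_mul, norm_mul, norm_I, norm_real, norm_real,
            Real.norm_eq_abs, Real.norm_eq_abs, one_mul]
      _ ≤ R ^ 2 * x ^ 2 + R * x ^ 2 := by gcongr
      _ ≤ _ := by nlinarith [mul_nonneg hquot (sq_nonneg x)]
  · have hδmin : δ ^ 2 ≤ min 1 (x ^ 2) := by
      refine le_min (pow_le_one₀ hδ.le hδ1) ?_
      rw [← sq_abs x]
      gcongr
    have hexp : ‖Complex.exp (I * z * x)‖ = 1 := by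
      rw [show I * (z : ℂ) * x = ((z * x : ℝ) : ℂ) * I by push_cast; ring, norm_exp_ofReal_mul_I]
    calc ‖Complex.exp (I * z * x) - 1 - I * z * c x‖
        ≤ ‖Complex.exp (I * z * x)‖ + ‖(1 : ℂ)‖ + ‖I * z * c x‖ :=
          (norm_sub_le _ _).trans (by gcongr; exact norm_sub_le _ _)
      _ = 2 + |z| * |c x| := by
          rw [hexp, norm_one, norm_mul, norm_mul, norm_I, norm_real, norm_real,
            Real.norm_eq_abs, Real.norm_eq_abs]
          ring
      _ ≤ 2 + R * M := by gcongr; exact hM x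
      _ = (2 + R * M) / δ ^ 2 * δ ^ 2 := by field_simp
      _ ≤ (2 + R * M) / δ ^ 2 * min 1 (x ^ 2) := by gcongr
      _ ≤ _ := by gcongr; nlinarith

lemma integrable_gKer (hc : IsRepFn c) (ζ : Measure ℝ) [IsFiniteMeasure ζ] (z : ℝ) :
    Integrable (gKer c · z) ζ := by
  obtain ⟨C, hC⟩ := hc.norm_gKer_le (abs_nonneg z)
  exact Integrable.of_bound (hc.measurable_gKer z).aestronglyMeasurable C
    (ae_of_all _ (hC z le_rfl))

lemma continuousAt_integral_gKer (hc : IsRepFn c) (ζ : Measure ℝ) [IsFiniteMeasure ζ] :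
    ContinuousAt (fun z ↦ ∫ x, gKer c x z ∂ζ) 0 := by
  obtain ⟨C, hC⟩ := hc.norm_gKer_le zero_le_one
  refine continuousAt_of_dominated (bound := fun _ ↦ C)
    (Eventually.of_forall fun z ↦ (hc.measurable_gKer z).aestronglyMeasurable) ?_
    (integrable_const C) (ae_of_all _ fun x ↦ (continuous_gKer c x).continuousAt)
  filter_upwards [Metric.ball_mem_nhds (0 : ℝ) one_pos] with z hz
  rw [Metric.mem_ball, dist_zero_right, Real.norm_eq_abs] at hz
  exact ae_of_all _ (hC z hz.le)

/-- The Lévy–Khintchine formula when the Lévy measure is supported away from `0`. -/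
lemma isCharFun_exp_setIntegral_gKer (hc : IsRepFn c) (γ : ℝ) (ζ : Measure ℝ) [IsFiniteMeasure ζ]
    {ε : ℝ} (hε : 0 < ε) :
    IsCharFun fun z ↦ Complex.exp (I * γ * z + ∫ x in {x | ε < |x|} ∪ {0}, gKer c x z ∂ζ) := by
  obtain ⟨hcm, ⟨M, hM⟩, -⟩ := id hc
  set S : Set ℝ := {x | ε < |x|}
  have hS : MeasurableSet S := measurableSet_lt measurable_const measurable_id.abs
  have hdisj : Disjoint S {0} := by simp [S, hε.le]
  let w : ℝ → NNReal := fun x ↦ (min 1 (x ^ 2)).toNNReal⁻¹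
  have hw : Measurable w := by fun_prop
  have hwS : ∀ x ∈ S, w x ≤ (min 1 (ε ^ 2)).toNNReal⁻¹ := fun x hx ↦ by
    have hx : ε < |x| := hx
    have : ε ^ 2 ≤ x ^ 2 := by rw [← sq_abs x]; gcongr
    simp only [w]
    gcongr
  let ν : Measure ℝ := (ζ.restrict S).withDensity fun x ↦ w x
  have : IsFiniteMeasure ν := by
    refine isFiniteMeasure_withDensity (ne_top_of_le_ne_top
      (ENNReal.mul_ne_top (ENNReal.coe_ne_top (r := (min 1 (ε ^ 2)).toNNReal⁻¹))
        (measure_ne_top ζ S)) ?_)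
    rw [← setLIntegral_const]
    exact setLIntegral_mono measurable_const fun x hx ↦ ENNReal.coe_le_coe.2 (hwS x hx)
  have hcint : Integrable (fun x ↦ (c x : ℂ)) ν :=
    Integrable.of_bound (by fun_prop) M (ae_of_all _ fun x ↦ by
      simpa only [norm_real, Real.norm_eq_abs] using hM x)
  have hint (z : ℝ) : Integrable (fun x : ℝ ↦ Complex.exp (z * x * I)) ν := by
    refine Integrable.of_bound (by fun_prop) 1 (ae_of_all _ fun x ↦ ?_)
    rw [← ofReal_mul, norm_exp_ofReal_mul_I]
  have hSint (z : ℝ) : ∫ x in S, gKer c x z ∂ζ =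
      charFun ν z - ν.real Set.univ - I * z * ((∫ x, c x ∂ν : ℝ) : ℂ) := by
    have : ∫ x in S, gKer c x z ∂ζ =
        ∫ x, (Complex.exp (z * x * I) - 1 - I * z * c x) ∂ν := by
      rw [integral_withDensity_eq_integral_smul hw]
      refine setIntegral_congr_fun hS fun x hx ↦ ?_
      have hx0 : x ≠ 0 := by
        rintro rfl
        simp only [S, Set.mem_ofPred_eq, abs_zero] at hx
        exact hx.not_gt hε
      have hmin : 0 ≤ min 1 (x ^ 2) := by positivity
      simp only [gKer, if_neg hx0, w, NNReal.smul_def, NNReal.coe_inv, Real.coe_toNNReal _ hmin,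
        real_smul, ofReal_inv]
      rw [div_eq_inv_mul]
      ring_nf
    rw [this, integral_sub (by exact (hint z).sub (integrable_const 1)) (hcint.const_mul _),
      integral_sub (hint z) (integrable_const 1), integral_const_mul, charFun_apply_real,
      integral_const, integral_complex_ofReal]
    simp
  convert (IsCharFun.gaussian (γ - ∫ x, c x ∂ν) (measureReal_nonneg (μ := ζ) (s := {0}))).mul
    (IsCharFun.compoundPoisson ν) using 2 with z
  rw [← Complex.exp_add, setIntegral_union hdisj (measurableSet_singleton 0)
    (hc.integrable_gKer ζ z).integrableOn (hc.integrable_gKer ζ z).integrableOn, hSint,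
    integral_singleton]
  congr 1
  simp only [gKer, if_pos, real_smul]
  push_cast
  ring

/-- The Lévy–Khintchine formula: every finite measure and drift arise from a probability
measure. -/
lemma exists_charFn_eq (hc : IsRepFn c) (γ : ℝ) (ζ : Measure ℝ) [IsFiniteMeasure ζ] :
    ∃ μ : Measure ℝ, IsProbabilityMeasure μ ∧
      ∀ z, charFn μ z = Complex.exp (I * γ * z + ∫ x, gKer c x z ∂ζ) := by
  simp only [charFn_eq_charFun]
  let S : ℕ → Set ℝ := fun n ↦ {x | 1 / ((n : ℝ) + 1) < |x|} ∪ {0}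
  have hS : ∀ n, MeasurableSet (S n) := fun n ↦
    (measurableSet_lt measurable_const measurable_id.abs).union (measurableSet_singleton 0)
  have hmono : Monotone S := fun m n hmn ↦
    Set.union_subset_union_left _ fun x hx ↦ by
    exact (Nat.one_div_le_one_div (α := ℝ) hmn).trans_lt hx
  have hU : ⋃ n, S n = Set.univ := Set.eq_univ_of_forall fun x ↦ by
    rcases eq_or_ne x 0 with rfl | hx
    · exact Set.mem_iUnion.2 ⟨0, Or.inr rfl⟩
    · obtain ⟨n, hn⟩ := exists_nat_one_div_lt (abs_pos.2 hx)
      exact Set.mem_iUnion.2 ⟨n, Or.inl hn⟩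
  refine IsCharFun.of_tendsto
    (fun n ↦ hc.isCharFun_exp_setIntegral_gKer γ ζ (Nat.one_div_pos_of_nat (n := n)))
    ?_ fun z ↦ ?_
  · exact ((by fun_prop : Continuous fun z : ℝ ↦ I * γ * z).continuousAt.add
      (hc.continuousAt_integral_gKer ζ)).cexp
  · have := tendsto_setIntegral_of_monotone hS hmono
      (hc.integrable_gKer ζ z).integrableOn
    rw [hU, setIntegral_univ] at this
    exact (this.const_add _).cexp

end IsRepFn

lemma MeasureTheory.Measure.add_sub_eq_add_sub_swap {X : Type*} [MeasurableSpace X]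
    (μ ν : Measure X) [IsFiniteMeasure μ] [IsFiniteMeasure ν] :
    μ + (ν - μ) = ν + (μ - ν) := by
  rw [← toSignedMeasure_eq_toSignedMeasure_iff, toSignedMeasure_add, toSignedMeasure_add,
    add_comm ν.toSignedMeasure, ← sub_eq_sub_iff_add_eq_add]
  exact sub_toSignedMeasure_eq_toSignedMeasure_sub

/-- μ is quasi-infinitely divisible iff there exist infinitely divisible
distributions μ₁, μ₂ with μ̂₁ = μ̂ ⬝ μ̂₂. -/
theorem stmt0 (c : ℝ → ℝ) (hc : IsRepFn c) (μ : Measure ℝ) [IsProbabilityMeasure μ] :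
    IsQID c μ ↔ ∃ μ₁ μ₂ : Measure ℝ, IsProbabilityMeasure μ₁ ∧ IsProbabilityMeasure μ₂ ∧
      IsID c μ₁ ∧ IsID c μ₂ ∧ ∀ z : ℝ, charFn μ₁ z = charFn μ z * charFn μ₂ z := by
  constructor
  · rintro ⟨γ, ζp, ζm, hp, hm, -, h⟩
    obtain ⟨μ₁, h₁, hμ₁⟩ := hc.exists_charFn_eq γ ζp
    obtain ⟨μ₂, h₂, hμ₂⟩ := hc.exists_charFn_eq 0 ζm
    refine ⟨μ₁, μ₂, h₁, h₂, ⟨γ, ζp, hp, hμ₁⟩, ⟨0, ζm, hm, hμ₂⟩, fun z ↦ ?_⟩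
    rw [hμ₁, h, hμ₂, ← Complex.exp_add]
    congr 1
    push_cast
    ring
  · rintro ⟨μ₁, μ₂, -, -, ⟨γ₁, ζ₁, h₁, hμ₁⟩, ⟨γ₂, ζ₂, h₂, hμ₂⟩, h⟩
    refine ⟨γ₁ - γ₂, ζ₁ - ζ₂, ζ₂ - ζ₁, inferInstance, inferInstance,
      Measure.mutually_singular_measure_sub, fun z ↦ ?_⟩
    have hz : charFn μ z = charFn μ₁ z / charFn μ₂ z := by
      rw [h, mul_div_cancel_right₀]
      rw [hμ₂]
      exact Complex.exp_ne_zero _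
    have hint (ζ : Measure ℝ) [IsFiniteMeasure ζ] : Integrable (gKer c · z) ζ :=
      hc.integrable_gKer ζ z
    have key := congrArg (fun ζ ↦ ∫ x, gKer c x z ∂ζ) (Measure.add_sub_eq_add_sub_swap ζ₁ ζ₂)
    simp only [integral_add_measure (hint _) (hint _)] at key
    rw [hz, hμ₁, hμ₂, ← Complex.exp_sub]
    congr 1
    push_cast
    linear_combination key
end
end

section
/- The set of quasi-infinitely divisible distributions on ℝ (indeed, those with finite quasi-Lévy measure and zero Gaussian variance) is dense in the set of all probability distributions on ℝ with respect to weak convergence. -/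
open MeasureTheory Complex Filter

noncomputable section

/-- The exponent attached to a sequence of lattice jump weights. -/
def jumpExponent (l : ℤ → ℂ) (θ : ℝ) : ℂ := ∑' n : ℤ, l n * (exp (I * n * θ) - 1)

/-- `F` is the exponential of a drift term plus a lattice jump exponent with summable complex
weights. -/
def HasExpRep (F : ℝ → ℂ) : Prop :=
  ∃ (γ : ℝ) (l : ℤ → ℂ), Summable (fun n => ‖l n‖) ∧
    ∀ θ : ℝ, F θ = exp (I * γ * θ + jumpExponent l θ)

lemma norm_exp_I_mul_int (n : ℤ) (θ : ℝ) : ‖exp (I * n * θ)‖ = 1 := by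
  rw [Complex.norm_exp]; simp

lemma norm_jump_le (a : ℂ) (n : ℤ) (θ : ℝ) : ‖a * (exp (I * n * θ) - 1)‖ ≤ ‖a‖ * 2 := by
  rw [norm_mul]
  gcongr
  refine (norm_sub_le _ _).trans ?_
  rw [norm_exp_I_mul_int]; norm_num

lemma summable_jump {l : ℤ → ℂ} (hl : Summable (fun n => ‖l n‖)) (θ : ℝ) :
    Summable (fun n : ℤ => l n * (exp (I * n * θ) - 1)) :=
  Summable.of_norm_bounded (hl.mul_right 2) fun _ => norm_jump_le _ _ _

lemma continuous_jumpExponent {l : ℤ → ℂ} (hl : Summable (fun n => ‖l n‖)) :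
    Continuous (jumpExponent l) :=
  continuous_tsum (fun _ => by fun_prop) (hl.mul_right 2) fun n θ => norm_jump_le _ _ _

lemma jumpExponent_add {l m : ℤ → ℂ} (hl : Summable (fun n => ‖l n‖))
    (hm : Summable (fun n => ‖m n‖)) (θ : ℝ) :
    jumpExponent (fun n => l n + m n) θ = jumpExponent l θ + jumpExponent m θ := by
  unfold jumpExponent
  rw [← (summable_jump hl θ).tsum_add (summable_jump hm θ)]
  simp_rw [add_mul]

lemma jumpExponent_neg (l : ℤ → ℂ) (θ : ℝ) :
    jumpExponent l (-θ) = jumpExponent (fun n => l (-n)) θ := by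
  unfold jumpExponent
  rw [← (Equiv.neg ℤ).tsum_eq]
  simp

lemma conj_jumpExponent (l : ℤ → ℂ) (θ : ℝ) :
    (starRingEnd ℂ) (jumpExponent l (-θ)) =
      jumpExponent (fun n => (starRingEnd ℂ) (l n)) θ := by
  unfold jumpExponent
  rw [conj_tsum]
  simp [← exp_conj]

lemma HasExpRep.const_one : HasExpRep fun _ => 1 :=
  ⟨0, 0, by simp, fun θ => by simp [jumpExponent]⟩

lemma HasExpRep.mul {F G : ℝ → ℂ} (hF : HasExpRep F) (hG : HasExpRep G) :
    HasExpRep fun θ => F θ * G θ := by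
  obtain ⟨γ, l, hl, hF⟩ := hF
  obtain ⟨δ, m, hm, hG⟩ := hG
  refine ⟨γ + δ, fun n => l n + m n,
    Summable.of_nonneg_of_le (fun n => norm_nonneg _) (fun n => norm_add_le _ _) (hl.add hm),
    fun θ => ?_⟩
  simp only [hF, hG]
  rw [← Complex.exp_add, jumpExponent_add hl hm]
  congr 1
  push_cast
  ring

lemma HasExpRep.comp_neg {F : ℝ → ℂ} (hF : HasExpRep F) : HasExpRep fun θ => F (-θ) := by
  obtain ⟨γ, l, hl, hF⟩ := hF
  refine ⟨-γ, fun n => l (-n), (Equiv.neg ℤ).summable_iff.mpr hl, fun θ => ?_⟩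
  simp only [hF]
  rw [jumpExponent_neg]
  push_cast
  congr 2
  ring

lemma HasExpRep.exp_I : HasExpRep fun θ => exp (I * θ) :=
  ⟨1, 0, by simp, fun θ => by simp [jumpExponent]⟩

lemma HasExpRep.one_sub_mul {α : ℂ} (hα : ‖α‖ < 1) :
    HasExpRep fun θ => (1 - α * exp (I * θ)) / (1 - α) := by
  have hinj : Function.Injective (Nat.cast : ℕ → ℤ) := Nat.cast_injective
  set l : ℤ → ℂ := Function.extend (Nat.cast : ℕ → ℤ) (fun n : ℕ => -(α ^ n / n)) 0 with hl
  have hne {z : ℂ} (hz : ‖z‖ < 1) : 1 - z ≠ 0 := by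
    intro h
    rw [← sub_eq_zero.mp h] at hz
    simp at hz
  refine ⟨0, l, ?_, fun θ => ?_⟩
  · have h : (fun n => ‖l n‖) =
        Function.extend (Nat.cast : ℕ → ℤ) (fun n : ℕ => ‖α ^ n / n‖) 0 := by
      funext n
      by_cases hn : ∃ k : ℕ, (k : ℤ) = n
      · obtain ⟨k, rfl⟩ := hn
        rw [hl, hinj.extend_apply, hinj.extend_apply, norm_neg]
      · rw [hl, Function.extend_apply' _ _ _ hn, Function.extend_apply' _ _ _ hn]
        simp
    rw [h, summable_extend_zero hinj]
    refine Summable.of_nonneg_of_le (fun n => norm_nonneg _) (fun n => ?_)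
      (summable_geometric_of_lt_one (norm_nonneg α) hα)
    rw [norm_div, norm_pow]
    rcases Nat.eq_zero_or_pos n with rfl | hn
    · simp
    · refine div_le_self (by positivity) ?_
      simpa using! hn
  · have hw : ‖α * exp (I * θ)‖ < 1 := by
      rw [norm_mul, Complex.norm_exp]; simpa using hα
    have hs := (Complex.hasSum_taylorSeries_neg_log hα).sub
      (Complex.hasSum_taylorSeries_neg_log hw)
    have h : jumpExponent l θ = log (1 - α * exp (I * θ)) - log (1 - α) := by
      have h' : (fun n : ℤ => l n * (exp (I * n * θ) - 1)) =
          Function.extend (Nat.cast : ℕ → ℤ)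
            (fun n : ℕ => α ^ n / n - (α * exp (I * θ)) ^ n / n) 0 := by
        funext n
        by_cases hn : ∃ k : ℕ, (k : ℤ) = n
        · obtain ⟨k, rfl⟩ := hn
          rw [hl, hinj.extend_apply, hinj.extend_apply, mul_pow, ← Complex.exp_nat_mul,
            show I * ((k : ℤ) : ℂ) * θ = k * (I * θ) by push_cast; ring]
          ring
        · rw [hl, Function.extend_apply' _ _ _ hn, Function.extend_apply' _ _ _ hn]
          simp
      unfold jumpExponent
      rw [h', ((hasSum_extend_zero hinj).mpr hs).tsum_eq]
      ring
    rw [h]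
    simp only [ofReal_zero, mul_zero, zero_mul, zero_add]
    rw [Complex.exp_sub, Complex.exp_log (hne hw), Complex.exp_log (hne hα)]

lemma HasExpRep.sub_div {β : ℂ} (hβ : ‖β‖ ≠ 1) :
    HasExpRep fun θ => (exp (I * θ) - β) / (1 - β) := by
  have h1 : 1 - β ≠ 0 := by
    intro h
    apply hβ
    rw [← sub_eq_zero.mp h]
    simp
  rcases lt_or_gt_of_ne hβ with h | h
  · have := HasExpRep.exp_I.mul (HasExpRep.one_sub_mul h).comp_neg
    convert this using 2 with θ
    have : exp (I * θ) * exp (-(I * θ)) = 1 := by rw [← Complex.exp_add]; simp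
    push_cast
    field_simp
    linear_combination β * this
  · have hβ0 : β ≠ 0 := by
      rintro rfl
      simp at h
      linarith
    have := HasExpRep.one_sub_mul (α := β⁻¹) (by rw [norm_inv]; exact inv_lt_one_of_one_lt₀ h)
    convert this using 2 with θ
    have h2 : 1 - β⁻¹ ≠ 0 := by
      intro h; apply h1; field_simp at h; linear_combination -h
    have h3 : β - 1 ≠ 0 := by
      intro h; apply h1; linear_combination -h
    field_simp
    ring

lemma HasExpRep.eval_div {q : Polynomial ℂ} (hq : q ≠ 0) {ρ : ℝ} (hρ : 0 < ρ)
    (hroot : ∀ α ∈ q.roots, ‖α‖ ≠ ρ) :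
    HasExpRep fun θ => q.eval (ρ * exp (I * θ)) / q.eval (ρ : ℂ) := by
  have key : ∀ s : Multiset ℂ, (∀ α ∈ s, ‖α‖ ≠ ρ) →
      HasExpRep fun θ => (s.map fun α => (ρ * exp (I * θ) - α) / (ρ - α)).prod := by
    intro s
    induction s using Multiset.induction with
    | empty => intro _; simpa using HasExpRep.const_one
    | cons α s ih =>
      intro hs
      simp only [Multiset.map_cons, Multiset.prod_cons]
      refine HasExpRep.mul ?_ (ih fun β hβ => hs β (Multiset.mem_cons_of_mem hβ))
      have hα := hs α (Multiset.mem_cons_self α s)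
      have hρ' : (ρ : ℂ) ≠ 0 := by exact_mod_cast hρ.ne'
      have := HasExpRep.sub_div (β := α / ρ) (by
        rw [norm_div, Complex.norm_real, Real.norm_of_nonneg hρ.le]
        intro h
        exact hα ((div_eq_one_iff_eq hρ.ne').mp h))
      convert this using 2 with θ
      rw [← mul_div_mul_left (exp (I * θ) - α / ρ) _ hρ', mul_sub, mul_sub, mul_one,
        mul_div_cancel₀ _ hρ']
  convert key q.roots hroot using 2 with θ
  rw [(IsAlgClosed.splits q).eval_eq_prod_roots, (IsAlgClosed.splits q).eval_eq_prod_roots,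
    Multiset.prod_map_div,
    mul_div_mul_left _ _ (Polynomial.leadingCoeff_ne_zero.mpr hq)]

/-- A Hermitian function with a complex exponential representation has one with real weights. -/
lemma HasExpRep.exists_real {F : ℝ → ℂ} (hF : HasExpRep F)
    (hconj : ∀ θ, (starRingEnd ℂ) (F (-θ)) = F θ) :
    ∃ (γ : ℝ) (l : ℤ → ℝ), Summable (fun n => |l n|) ∧ l 0 = 0 ∧
      ∀ θ : ℝ, F θ = exp (I * γ * θ + jumpExponent (fun n => l n) θ) := by
  obtain ⟨γ, l, hl, hF⟩ := hF
  set m : ℤ → ℝ := fun n => if n = 0 then 0 else (l n).re with hm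
  have hms : Summable (fun n => |m n|) := by
    refine Summable.of_nonneg_of_le (fun n => abs_nonneg _) (fun n => ?_) hl
    by_cases hn : n = 0
    · simp [hm, hn]
    · simpa [hm, hn] using Complex.abs_re_le_norm (l n)
  have hms' : Summable (fun n => ‖((m n : ℝ) : ℂ)‖) := by simpa using hms
  refine ⟨γ, m, hms, by simp [hm], ?_⟩
  have hcl : Summable (fun n => ‖(starRingEnd ℂ) (l n)‖) := by simpa using hl
  have hdouble (θ : ℝ) : jumpExponent l θ + jumpExponent (fun n => (starRingEnd ℂ) (l n)) θ =
      jumpExponent (fun n => m n) θ + jumpExponent (fun n => m n) θ := by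
    rw [← jumpExponent_add hl hcl, ← jumpExponent_add hms' hms']
    unfold jumpExponent
    congr 1
    funext n
    by_cases hn : n = 0
    · simp [hn]
    · simp only [hm, hn, if_false, Complex.add_conj]
      push_cast
      ring
  have hcF : Continuous F := by
    rw [funext hF]
    have := continuous_jumpExponent hl
    fun_prop
  have hcG : Continuous fun θ : ℝ => exp (I * γ * θ + jumpExponent (fun n => m n) θ) := by
    have := continuous_jumpExponent hms'
    fun_prop
  have hsq : Set.EqOn (F ^ 2)
      ((fun θ : ℝ => exp (I * γ * θ + jumpExponent (fun n => m n) θ)) ^ 2) Set.univ := by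
    intro θ _
    simp only [Pi.pow_apply]
    rw [sq, sq]
    nth_rewrite 2 [← hconj θ]
    rw [hF, hF, ← Complex.exp_conj, ← Complex.exp_add, ← Complex.exp_add, map_add,
      conj_jumpExponent]
    congr 1
    simp only [map_mul, conj_I, conj_ofReal, ofReal_neg, map_neg]
    linear_combination hdouble θ
  intro θ
  exact isPreconnected_univ.eq_of_sq_eq hcF.continuousOn hcG.continuousOn hsq
    (fun _ => Complex.exp_ne_zero _) (Set.mem_univ 0) (by simp [hF, jumpExponent]) (Set.mem_univ θ)

/-- The measure on the lattice `hℤ` whose atom at `n * h` is the positive part of `w n`. -/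
def latticeMeasure (w : ℤ → ℝ) (h : ℝ) : Measure ℝ :=
  Measure.sum fun n : ℤ => ENNReal.ofReal (w n) • Measure.dirac (n * h)

lemma isFiniteMeasure_latticeMeasure {w : ℤ → ℝ} (hw : Summable fun n => |w n|) (h : ℝ) :
    IsFiniteMeasure (latticeMeasure w h) := by
  constructor
  rw [latticeMeasure, Measure.sum_apply _ MeasurableSet.univ]
  refine lt_of_le_of_lt ?_ hw.tsum_ofReal_lt_top
  refine ENNReal.tsum_le_tsum fun n => ?_
  simpa using ENNReal.ofReal_le_ofReal (le_abs_self (w n))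

lemma latticeMeasure_zero {w : ℤ → ℝ} (hw : w 0 = 0) {h : ℝ} (hh : h ≠ 0) :
    latticeMeasure w h {0} = 0 := by
  rw [latticeMeasure, Measure.sum_apply _ (measurableSet_singleton _), ENNReal.tsum_eq_zero]
  intro n
  by_cases hn : n = 0
  · simp [hn, hw]
  · simp [hn, hh]

lemma mutuallySingular_latticeMeasure (w : ℤ → ℝ) {h : ℝ} (hh : h ≠ 0) :
    Measure.MutuallySingular (latticeMeasure w h) (latticeMeasure (fun n => -w n) h) := by
  unfold latticeMeasure
  refine Measure.MutuallySingular.sum_left.mpr fun i =>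
    Measure.MutuallySingular.sum_right.mpr fun j => ?_
  by_cases hi : w i ≤ 0
  · rw [ENNReal.ofReal_of_nonpos hi, zero_smul]
    exact Measure.MutuallySingular.zero_left
  by_cases hj : -w j ≤ 0
  · rw [ENNReal.ofReal_of_nonpos hj, zero_smul]
    exact Measure.MutuallySingular.zero_right
  have hij : j ≠ i := by
    rintro rfl
    linarith
  refine ⟨{(i * h : ℝ)}ᶜ, (measurableSet_singleton _).compl, by simp, ?_⟩
  simp [hij, hh]

lemma integral_latticeMeasure (w : ℤ → ℝ) (h z : ℝ) :
    ∫ x, (exp (I * z * x) - 1) ∂latticeMeasure w h =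
      jumpExponent (fun n => ((max (w n) 0 : ℝ) : ℂ)) (z * h) := by
  rw [latticeMeasure, integral_sum_dirac fun _ => ENNReal.ofReal_ne_top]
  unfold jumpExponent
  congr 1
  funext n
  rw [ENNReal.toReal_ofReal', real_smul]
  rw [show I * (z : ℂ) * ((n * h : ℝ) : ℂ) = I * n * ((z * h : ℝ) : ℂ) by push_cast; ring]

lemma jumpExponent_eq_integral_sub {w : ℤ → ℝ} (hw : Summable fun n => |w n|) (h z : ℝ) :
    jumpExponent (fun n => w n) (z * h) = (∫ x, (exp (I * z * x) - 1) ∂latticeMeasure w h) -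
      ∫ x, (exp (I * z * x) - 1) ∂latticeMeasure (fun n => -w n) h := by
  have hmax (v : ℤ → ℝ) (hv : Summable fun n => |v n|) :
      Summable fun n => ‖((max (v n) 0 : ℝ) : ℂ)‖ := by
    refine Summable.of_nonneg_of_le (fun n => norm_nonneg _) (fun n => ?_) hv
    rw [Complex.norm_real, Real.norm_of_nonneg (le_max_right _ _)]
    exact max_le (le_abs_self _) (abs_nonneg _)
  rw [integral_latticeMeasure, integral_latticeMeasure, eq_sub_iff_add_eq,
    ← jumpExponent_add (by simpa using hw) (hmax _ (by simpa using hw))]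
  congr 1
  funext n
  norm_cast
  rcases le_total (w n) 0 with hn | hn
  · rw [max_eq_left (by linarith), max_eq_right hn]; ring
  · rw [max_eq_right (by linarith), max_eq_left hn]; ring

lemma exists_eval_eq_integral_pow {μ : Measure ℝ} [IsProbabilityMeasure μ] {k : ℝ → ℕ}
    (hk : Measurable k) {M : ℕ} (hM : ∀ x, k x ≤ M) :
    ∃ q : Polynomial ℂ, ∀ w : ℂ, q.eval w = ∫ x, w ^ k x ∂μ := by
  refine ⟨∑ j ∈ Finset.range (M + 1), Polynomial.monomial j (μ.real (k ⁻¹' {j}) : ℂ),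
    fun w => ?_⟩
  have hms (j : ℕ) : MeasurableSet (k ⁻¹' {j}) := hk (measurableSet_singleton j)
  have h (x : ℝ) : w ^ k x =
      ∑ j ∈ Finset.range (M + 1), (k ⁻¹' {j}).indicator (fun _ => w ^ j) x := by
    rw [Finset.sum_eq_single_of_mem (k x) (Finset.mem_range_succ_iff.mpr (hM x))]
    · simp
    · intro j _ hj
      exact Set.indicator_of_notMem (fun h => hj h.symm) _
  simp_rw [h]
  rw [integral_finsetSum _ fun j _ => (integrable_const _).indicator (hms j),
    Polynomial.eval_finsetSum]
  refine Finset.sum_congr rfl fun j _ => ?_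
  rw [integral_indicator_const _ (hms j), Polynomial.eval_monomial, real_smul]

/-- A bounded lattice distribution has arbitrarily small exponential tilts whose characteristic
function admits an exponential representation. -/
lemma exists_tilted_hasExpRep {μ : Measure ℝ} [IsProbabilityMeasure μ] {k : ℝ → ℕ}
    (hk : Measurable k) {M : ℕ} (hM : ∀ x, k x ≤ M) {ε : ℝ} (hε : 0 < ε) :
    ∃ t ∈ Set.Ioo 0 ε,
      HasExpRep fun θ => ∫ x, exp (I * θ * k x) ∂(μ.tilted fun x => t * k x) := by
  obtain ⟨q, hq⟩ := exists_eval_eq_integral_pow (μ := μ) hk hM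
  have hq0 : q ≠ 0 := by
    rintro rfl
    simpa using hq 1
  obtain ⟨t, ht, hbad⟩ := (Set.Ioo_infinite hε).exists_notMem_finset
    (q.roots.toFinset.image fun α => Real.log ‖α‖)
  refine ⟨t, ht, ?_⟩
  have hroot : ∀ α ∈ q.roots, ‖α‖ ≠ Real.exp t := by
    intro α hα h
    refine hbad (Finset.mem_image.mpr ⟨α, Multiset.mem_toFinset.mpr hα, ?_⟩)
    rw [h, Real.log_exp]
  convert HasExpRep.eval_div hq0 (Real.exp_pos t) hroot using 2 with θ
  have hZ : ((∫ x, Real.exp (t * k x) ∂μ : ℝ) : ℂ) = q.eval (Real.exp t : ℂ) := by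
    rw [hq, ← integral_complex_ofReal]
    congr 1
    funext x
    rw [mul_comm, Real.exp_nat_mul]
    push_cast
    rfl
  rw [integral_tilted, hq, ← hZ, ← integral_div]
  congr 1
  funext x
  rw [real_smul, mul_pow, ← Complex.exp_nat_mul, mul_comm t, Real.exp_nat_mul,
    show I * (θ : ℂ) * k x = k x * (I * θ) by ring]
  push_cast
  ring

/-- Lattice index of the truncated discretization of mesh `1 / (N + 1)`. -/
def latticeIndex (N : ℕ) (x : ℝ) : ℕ :=
  min (2 * (N + 1) ^ 2) ⌊((N : ℝ) + 1) * x + ((N : ℝ) + 1) ^ 2⌋₊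

lemma measurable_latticeIndex (N : ℕ) : Measurable (latticeIndex N) := by
  unfold latticeIndex
  fun_prop

/-- The point of the lattice with index `k`. -/
def latticePoint (N k : ℕ) : ℝ := (k - ((N : ℝ) + 1) ^ 2) / ((N : ℝ) + 1)

lemma tendsto_latticePoint (x : ℝ) :
    Tendsto (fun N => latticePoint N (latticeIndex N x)) atTop (nhds x) := by
  rw [tendsto_iff_norm_sub_tendsto_zero]
  refine squeeze_zero' (Eventually.of_forall fun _ => norm_nonneg _) ?_
    tendsto_one_div_add_atTop_nhds_zero_nat
  filter_upwards [eventually_ge_atTop ⌈|x|⌉₊] with N hN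
  have hx : |x| ≤ N := (Nat.le_ceil _).trans (by exact_mod_cast hN)
  obtain ⟨hx1, hx2⟩ := abs_le.mp hx
  have hN0 : (0 : ℝ) < (N : ℝ) + 1 := by positivity
  set y : ℝ := ((N : ℝ) + 1) * x + ((N : ℝ) + 1) ^ 2 with hy
  have hy0 : 0 ≤ y := by nlinarith
  have hle : ⌊y⌋₊ ≤ 2 * (N + 1) ^ 2 := by
    refine Nat.floor_le_of_le ?_
    push_cast
    nlinarith
  have h1 := Nat.floor_le hy0
  have h2 := Nat.lt_floor_add_one y
  have h3 : latticePoint N (latticeIndex N x) - x = (⌊y⌋₊ - y) / ((N : ℝ) + 1) := by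
    rw [latticePoint, latticeIndex, ← hy, min_eq_right hle, hy]
    field_simp
    ring
  rw [h3, Real.norm_eq_abs, abs_div, abs_of_pos hN0]
  gcongr
  rw [abs_le]
  constructor <;> linarith

lemma integrable_of_bounded_nat {μ : Measure ℝ} [IsProbabilityMeasure μ] {k : ℝ → ℕ}
    (hk : Measurable k) {M : ℕ} (hM : ∀ x, k x ≤ M) {t : ℝ} (ht : 0 ≤ t) :
    Integrable (fun x => Real.exp (t * k x)) μ := by
  refine Integrable.of_bound (C := Real.exp (t * M)) (by fun_prop)
    (Eventually.of_forall fun x => ?_)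
  rw [Real.norm_of_nonneg (Real.exp_pos _).le]
  gcongr
  exact hM x

lemma latticeIndex_le (N : ℕ) (x : ℝ) : latticeIndex N x ≤ 2 * (N + 1) ^ 2 := min_le_left _ _

/-- Tilts of the lattice discretizations converge weakly, provided the tilting parameters vanish
fast enough. -/
lemma tendsto_integral_tilted_lattice (μ : Measure ℝ) [IsProbabilityMeasure μ] {t : ℕ → ℝ}
    (ht : ∀ N, 0 < t N ∧ t N < 1 / (2 * ((N : ℝ) + 1) ^ 3)) (f : BoundedContinuousFunction ℝ ℝ) :
    Tendsto (fun N => ∫ x, f (latticePoint N (latticeIndex N x))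
      ∂(μ.tilted fun x => t N * latticeIndex N x)) atTop (nhds (∫ x, f x ∂μ)) := by
  have hbound (N : ℕ) (x : ℝ) : t N * latticeIndex N x ≤ 1 / ((N : ℝ) + 1) := by
    have hk : (latticeIndex N x : ℝ) ≤ 2 * ((N : ℝ) + 1) ^ 2 := by
      exact_mod_cast latticeIndex_le N x
    calc t N * latticeIndex N x ≤ 1 / (2 * ((N : ℝ) + 1) ^ 3) * (2 * ((N : ℝ) + 1) ^ 2) := by
          gcongr
          exact (ht N).2.le
      _ = 1 / ((N : ℝ) + 1) := by field_simp
  have hnonneg (N : ℕ) (x : ℝ) : 0 ≤ t N * latticeIndex N x :=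
    mul_nonneg (ht N).1.le (Nat.cast_nonneg _)
  have hle_one (N : ℕ) (x : ℝ) : Real.exp (t N * latticeIndex N x) ≤ Real.exp 1 := by
    gcongr
    refine (hbound N x).trans ?_
    rw [div_le_one (by positivity)]
    linarith [Nat.cast_nonneg (α := ℝ) N]
  have hexp (x : ℝ) : Tendsto (fun N => Real.exp (t N * latticeIndex N x)) atTop (nhds 1) := by
    rw [← Real.exp_zero]
    exact (Real.continuous_exp.tendsto 0).comp
      (squeeze_zero (fun N => hnonneg N x) (fun N => hbound N x)
        tendsto_one_div_add_atTop_nhds_zero_nat)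
  have hmeas (N : ℕ) : Measurable fun x => Real.exp (t N * latticeIndex N x) := by
    have := measurable_latticeIndex N
    fun_prop
  have hZ : Tendsto (fun N => ∫ x, Real.exp (t N * latticeIndex N x) ∂μ) atTop (nhds 1) := by
    have := tendsto_integral_of_dominated_convergence (μ := μ) (fun _ => Real.exp 1)
      (fun N => (hmeas N).aestronglyMeasurable) (integrable_const _)
      (fun N => Eventually.of_forall fun x => by
        rw [Real.norm_of_nonneg (Real.exp_pos _).le]; exact hle_one N x)
      (Eventually.of_forall hexp)
    simpa using this
  have hnum : Tendsto (fun N => ∫ x, Real.exp (t N * latticeIndex N x) *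
      f (latticePoint N (latticeIndex N x)) ∂μ) atTop (nhds (∫ x, f x ∂μ)) := by
    refine tendsto_integral_of_dominated_convergence (fun _ => Real.exp 1 * ‖f‖)
      (fun N => ?_) (integrable_const _) (fun N => Eventually.of_forall fun x => ?_)
      (Eventually.of_forall fun x => ?_)
    · have h1 : Measurable (latticePoint N) := measurable_of_countable _
      exact ((hmeas N).mul (f.continuous.measurable.comp
        (h1.comp (measurable_latticeIndex N)))).aestronglyMeasurable
    · rw [norm_mul, Real.norm_of_nonneg (Real.exp_pos _).le]
      exact mul_le_mul (hle_one N x) (f.norm_coe_le_norm _) (norm_nonneg _) (Real.exp_pos _).le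
    · simpa using (hexp x).mul ((f.continuous.tendsto x).comp (tendsto_latticePoint x))
  have := hnum.div hZ one_ne_zero
  rw [div_one] at this
  refine this.congr fun N => ?_
  rw [Pi.div_apply, integral_tilted, ← integral_div]
  congr 1
  funext x
  rw [smul_eq_mul]
  ring

/-- every probability distribution on ℝ is a weak limit of
quasi-infinitely divisible distributions with finite quasi-Lévy measure and
zero Gaussian variance. -/
theorem stmt11 (c : ℝ → ℝ) (hc : IsRepFn c) (μ : Measure ℝ) [IsProbabilityMeasure μ] :
    ∃ μs : ℕ → Measure ℝ, (∀ n, IsProbabilityMeasure (μs n)) ∧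
      (∀ n, ∃ γ : ℝ, ∃ νp νm : Measure ℝ, IsFiniteMeasure νp ∧ IsFiniteMeasure νm ∧
        Measure.MutuallySingular νp νm ∧ νp {0} = 0 ∧ νm {0} = 0 ∧
        ∀ z : ℝ, charFn (μs n) z = Complex.exp (Complex.I * γ * z
          + (∫ x, (Complex.exp (Complex.I * z * x) - 1) ∂νp)
          - ∫ x, (Complex.exp (Complex.I * z * x) - 1) ∂νm)) ∧
      ∀ f : BoundedContinuousFunction ℝ ℝ,
        Tendsto (fun n => ∫ x, f x ∂(μs n)) atTop (nhds (∫ x, f x ∂μ)) := by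
  choose t ht hrep using fun N : ℕ => exists_tilted_hasExpRep (μ := μ)
    (measurable_latticeIndex N) (latticeIndex_le N)
    (ε := 1 / (2 * ((N : ℝ) + 1) ^ 3)) (by positivity)
  have hpoint (N : ℕ) : Measurable fun x => latticePoint N (latticeIndex N x) :=
    (measurable_of_countable (latticePoint N)).comp (measurable_latticeIndex N)
  have hprob (N : ℕ) : IsProbabilityMeasure (μ.tilted fun x => t N * latticeIndex N x) :=
    isProbabilityMeasure_tilted (integrable_of_bounded_nat (measurable_latticeIndex N)
      (latticeIndex_le N) (ht N).1.le)
  refine ⟨fun N => (μ.tilted fun x => t N * latticeIndex N x).map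
    fun x => latticePoint N (latticeIndex N x),
    fun N => Measure.isProbabilityMeasure_map (hpoint N).aemeasurable, fun N => ?_, fun f => ?_⟩
  · obtain ⟨γ, w, hw, hw0, hF⟩ := (hrep N).exists_real fun θ => by
      rw [← integral_conj]
      simp [← Complex.exp_conj]
    have hN : ((N : ℝ) + 1) ≠ 0 := by positivity
    set h : ℝ := 1 / ((N : ℝ) + 1) with hh
    have hh0 : h ≠ 0 := one_div_ne_zero hN
    refine ⟨γ * h - ((N : ℝ) + 1), latticeMeasure w h, latticeMeasure (fun n => -w n) h,
      isFiniteMeasure_latticeMeasure hw h,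
      isFiniteMeasure_latticeMeasure (by simpa using hw) h,
      mutuallySingular_latticeMeasure w hh0, latticeMeasure_zero hw0 hh0,
      latticeMeasure_zero (by simp [hw0]) hh0, fun z => ?_⟩
    rw [charFn, integral_map (hpoint N).aemeasurable (by fun_prop), add_sub_assoc,
      ← jumpExponent_eq_integral_sub hw]
    have hsplit (x : ℝ) : exp (I * z * (latticePoint N (latticeIndex N x) : ℝ)) =
        exp (-(I * z * ((N : ℂ) + 1))) * exp (I * ((z * h : ℝ) : ℂ) * latticeIndex N x) := by
      rw [← Complex.exp_add, latticePoint, hh]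
      have : ((N : ℂ) + 1) ≠ 0 := by exact_mod_cast hN
      congr 1
      push_cast
      field_simp
      ring
    simp_rw [hsplit]
    rw [integral_const_mul, hF, ← Complex.exp_add]
    congr 1
    push_cast
    ring
  · refine (tendsto_integral_tilted_lattice μ (fun N => ht N) f).congr fun N => ?_
    rw [integral_map (hpoint N).aemeasurable f.continuous.aestronglyMeasurable]
end
end

section
/- Let c be a continuous representation function, (μ_n) a sequence of quasi-infinitely divisible distributions with characteristic pairs (ζ_n, γ_n)_c. If γ_n → γ ∈ ℝ and ζ_n converges weakly to a finite signed measure ζ (i.e., ∫f dζ_n → ∫f dζ for all bounded continuous f), then μ_n converges weakly to a quasi-infinitely divisible distribution μ with characteristic pair (ζ, γ)_c. -/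
open MeasureTheory Complex Filter

noncomputable section

open scoped Topology

/-- If the characteristic functions of a sequence of probability measures converge pointwise to a
function which is continuous at `0`, then the measures converge weakly to a probability measure
having that function as its characteristic function. -/
lemma exists_tendsto_of_tendsto_charFun {E : Type*} [NormedAddCommGroup E] [InnerProductSpace ℝ E]
    [FiniteDimensional ℝ E] [MeasurableSpace E] [BorelSpace E] {μ : ℕ → ProbabilityMeasure E}
    {f : E → ℂ} (hf : ContinuousAt f 0)
    (h : ∀ t, Tendsto (fun n => charFun (μ n : Measure E) t) atTop (𝓝 (f t))) :
    ∃ μ₀ : ProbabilityMeasure E, (∀ t, charFun (μ₀ : Measure E) t = f t) ∧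
      Tendsto μ atTop (𝓝 μ₀) := by
  have h_tight : IsTightMeasureSet {((ν : ProbabilityMeasure E) : Measure E) | ν ∈ Set.range μ} := by
    simpa [Set.range] using isTightMeasureSet_of_tendsto_charFun hf h
  have h_compact : IsCompact (closure (Set.range μ)) :=
    isCompact_closure_of_isTightMeasureSet h_tight
  obtain ⟨μ₀, -, hμ₀⟩ := h_compact.ultrafilter_le_nhds ((hyperfilter ℕ).map μ)
    (.trans (by simp) (monotone_principal subset_closure))
  have hμ₀' : Tendsto μ (hyperfilter ℕ : Filter ℕ) (𝓝 μ₀) := hμ₀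
  rw [ProbabilityMeasure.tendsto_iff_forall_integral_rclike_tendsto ℂ] at hμ₀'
  have h_eq (t : E) : charFun (μ₀ : Measure E) t = f t := by
    refine tendsto_nhds_unique ?_ ((h t).mono_left Nat.hyperfilter_le_atTop)
    simp_rw [charFun_eq_integral_innerProbChar]
    exact hμ₀' (BoundedContinuousFunction.innerProbChar t)
  exact ⟨μ₀, h_eq, ProbabilityMeasure.tendsto_of_tendsto_charFun fun t => h_eq t ▸ h t⟩

lemma IsRepFn.exists_abs_sub_le {c : ℝ → ℝ} (hc : IsRepFn c) :
    ∃ K : ℝ, 0 ≤ K ∧ ∀ x, x ≠ 0 → |x| ≤ 1 → |c x - x| ≤ K * x ^ 2 := by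
  obtain ⟨-, ⟨M, hM⟩, hlim⟩ := hc
  obtain ⟨δ, hδ, h⟩ := Metric.tendsto_nhdsWithin_nhds.1 hlim 1 one_pos
  have hM0 : 0 ≤ M := (abs_nonneg _).trans (hM 0)
  refine ⟨max 1 ((M + 1) / δ ^ 2), by positivity, fun x hx hx1 => ?_⟩
  have hx2 : 0 < x ^ 2 := by positivity
  by_cases hxδ : |x| < δ
  · have := h (x := x) hx (by simpa using hxδ)
    rw [Real.dist_eq, sub_zero, abs_div, abs_of_pos hx2, div_lt_one hx2] at this
    nlinarith [le_max_left (1 : ℝ) ((M + 1) / δ ^ 2)]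
  · have hδx : δ ^ 2 ≤ x ^ 2 := by
      rw [← sq_abs x]
      gcongr
      exact not_lt.1 hxδ
    calc |c x - x| ≤ |c x| + |x| := abs_sub _ _
      _ ≤ M + 1 := add_le_add (hM x) hx1
      _ = (M + 1) / δ ^ 2 * δ ^ 2 := by field_simp
      _ ≤ _ := by gcongr; exact le_max_right _ _

lemma gKer_eq_of_abs_le_one (c : ℝ → ℝ) {x : ℝ} (z : ℝ) (hx : x ≠ 0) (hx1 : |x| ≤ 1) :
    gKer c x z = (exp (I * z * x) - 1 - I * z * x) / (x : ℂ) ^ 2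
      - I * z * (((c x - x) / x ^ 2 : ℝ) : ℂ) := by
  have hmin : min 1 (x ^ 2) = x ^ 2 := min_eq_right ((sq_le_one_iff_abs_le_one x).2 hx1)
  have hx' : (x : ℂ) ≠ 0 := by exact_mod_cast hx
  rw [gKer, if_neg hx, hmin]
  push_cast
  field_simp
  ring

/-- `g_c(·, z)` is bounded, locally uniformly in `z`. -/
lemma IsRepFn.exists_norm_gKer_le {c : ℝ → ℝ} (hc : IsRepFn c) :
    ∃ K : ℝ, 0 ≤ K ∧ ∀ x z, ‖gKer c x z‖ ≤ 2 + z ^ 2 * Real.exp |z| + K * |z| := by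
  obtain ⟨K, hK, hcK⟩ := hc.exists_abs_sub_le
  obtain ⟨-, ⟨M, hM⟩, -⟩ := hc
  refine ⟨max K M, by positivity, fun x z => ?_⟩
  rcases eq_or_ne x 0 with rfl | hx
  · have h1 : (1 : ℝ) ≤ Real.exp |z| := Real.one_le_exp (abs_nonneg z)
    have h2 : 0 ≤ max K M * |z| := by positivity
    have h3 : ‖gKer c 0 z‖ = z ^ 2 / 2 := by simp [gKer]
    nlinarith [sq_nonneg z]
  rcases le_or_gt |x| 1 with hx1 | hx1
  · have hx2 : 0 < x ^ 2 := by positivity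
    have hn : ‖I * z * x‖ = |z| * |x| := by simp
    have hexp : ‖exp (I * z * x) - 1 - I * z * x‖ ≤ (|z| * |x|) ^ 2 * Real.exp (|z| * |x|) := by
      have := norm_exp_sub_sum_le_norm_mul_exp (I * z * x) 2
      rw [hn] at this
      convert this using 2
      simp [Finset.sum_range_succ]
      ring
    have h1 : ‖(exp (I * z * x) - 1 - I * z * x) / (x : ℂ) ^ 2‖ ≤ z ^ 2 * Real.exp |z| := by
      rw [norm_div, norm_pow, norm_real, Real.norm_eq_abs, sq_abs, div_le_iff₀ hx2]
      refine hexp.trans ?_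
      rw [mul_pow, sq_abs, sq_abs, mul_right_comm]
      gcongr
      exact mul_le_of_le_one_right (abs_nonneg z) hx1
    have h2 : ‖I * z * (((c x - x) / x ^ 2 : ℝ) : ℂ)‖ ≤ max K M * |z| := by
      rw [norm_mul, norm_mul, norm_I, one_mul, norm_real, norm_real, Real.norm_eq_abs,
        Real.norm_eq_abs, abs_div, abs_of_pos hx2, mul_comm]
      gcongr
      rw [div_le_iff₀ hx2]
      exact (hcK x hx hx1).trans (by gcongr; exact le_max_left _ _)
    rw [gKer_eq_of_abs_le_one c z hx hx1]
    linarith [norm_sub_le ((exp (I * z * x) - 1 - I * z * x) / (x : ℂ) ^ 2)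
      (I * z * (((c x - x) / x ^ 2 : ℝ) : ℂ))]
  · have hmin : min 1 (x ^ 2) = 1 := min_eq_left ((one_lt_sq_iff_one_lt_abs x).2 hx1).le
    have h1 : ‖exp (I * z * x)‖ = 1 := by
      rw [mul_assoc, ← ofReal_mul, norm_exp_I_mul_ofReal]
    have h2 : ‖I * z * c x‖ ≤ max K M * |z| := by
      rw [norm_mul, norm_mul, norm_I, one_mul, norm_real, norm_real, mul_comm]
      exact mul_le_mul_of_nonneg_right ((hM x).trans (le_max_right _ _)) (abs_nonneg z)
    have h3 := norm_sub_le (exp (I * z * x) - 1) (I * z * c x)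
    have h4 := norm_sub_le (exp (I * z * x)) 1
    rw [h1, norm_one] at h4
    rw [gKer, if_neg hx, hmin, ofReal_one, div_one]
    nlinarith [mul_nonneg (sq_nonneg z) (Real.exp_pos |z|).le]

lemma IsRepFn.continuousAt_gKer_zero {c : ℝ → ℝ} (hc : IsRepFn c) (z : ℝ) :
    ContinuousAt (fun x => gKer c x z) 0 := by
  rw [← continuousWithinAt_compl_self, ContinuousWithinAt, tendsto_iff_norm_sub_tendsto_zero]
  have hbound : Tendsto (fun x : ℝ => |z| ^ 3 * |x| * Real.exp (|z| * |x|)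
      + |z| * |(c x - x) / x ^ 2|) (𝓝[≠] 0) (𝓝 0) := by
    have h1 : Tendsto (fun x : ℝ => |z| ^ 3 * |x| * Real.exp (|z| * |x|)) (𝓝[≠] 0) (𝓝 0) := by
      have : Continuous fun x : ℝ => |z| ^ 3 * |x| * Real.exp (|z| * |x|) := by fun_prop
      simpa using (this.tendsto 0).mono_left nhdsWithin_le_nhds
    simpa using h1.add (hc.2.2.abs.const_mul |z|)
  refine squeeze_zero' (.of_forall fun _ => norm_nonneg _) ?_ hbound
  have hev : ∀ᶠ x : ℝ in 𝓝[≠] 0, |x| < 1 :=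
    nhdsWithin_le_nhds <|
    continuous_abs.continuousAt.eventually_lt_const (by simp)
  filter_upwards [hev, self_mem_nhdsWithin] with x hx1 hx
  have hx : x ≠ 0 := hx
  have hx' : (x : ℂ) ≠ 0 := by exact_mod_cast hx
  have hx2 : 0 < x ^ 2 := by positivity
  have hexp := norm_exp_sub_sum_le_norm_mul_exp (I * z * x) 3
  have hn : ‖I * z * x‖ = |z| * |x| := by simp
  rw [hn] at hexp
  have heq : gKer c x z - gKer c 0 z =
      (exp (I * z * x) - ∑ m ∈ Finset.range 3, (I * z * x) ^ m / m.factorial) / (x : ℂ) ^ 2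
        - I * z * (((c x - x) / x ^ 2 : ℝ) : ℂ) := by
    rw [gKer_eq_of_abs_le_one c z hx hx1.le, gKer, if_pos rfl]
    simp only [Finset.sum_range_succ, Finset.sum_range_zero, Nat.factorial]
    push_cast
    field_simp
    ring_nf
    simp only [I_sq]
    ring
  rw [heq]
  refine (norm_sub_le _ _).trans (add_le_add ?_ ?_)
  swap
  · rw [norm_mul, norm_mul, norm_I, one_mul, norm_real, norm_real, Real.norm_eq_abs,
      Real.norm_eq_abs]
  rw [norm_div, norm_pow, norm_real, Real.norm_eq_abs, sq_abs, div_le_iff₀ hx2]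
  refine hexp.trans_eq ?_
  rw [← sq_abs x]
  ring

lemma IsRepFn.continuous_gKer {c : ℝ → ℝ} (hc : IsRepFn c) (hcont : Continuous c) (z : ℝ) :
    Continuous fun x => gKer c x z := by
  refine continuous_iff_continuousAt.2 fun x => ?_
  rcases eq_or_ne x 0 with rfl | hx
  · exact hc.continuousAt_gKer_zero z
  have hev : (fun y : ℝ => (exp (I * z * y) - 1 - I * z * c y) / ((min 1 (y ^ 2) : ℝ) : ℂ))
      =ᶠ[𝓝 x] fun y => gKer c y z := by
    filter_upwards [isOpen_ne.mem_nhds hx] with y hy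
    rw [gKer, if_neg hy]
  refine ContinuousAt.congr (ContinuousAt.div (by fun_prop) (by fun_prop) ?_) hev
  have : 0 < min 1 (x ^ 2) := by positivity
  exact_mod_cast this.ne'

lemma continuous_gKer_right (c : ℝ → ℝ) (x : ℝ) : Continuous fun z => gKer c x z := by
  unfold gKer
  split_ifs <;> fun_prop

/-- `g_c(·, z)` as a bounded continuous function. -/
def gKerBCF {c : ℝ → ℝ} (hc : IsRepFn c) (hcont : Continuous c) (z : ℝ) :
    BoundedContinuousFunction ℝ ℂ :=
  BoundedContinuousFunction.ofNormedAddCommGroup (fun x => gKer c x z) (hc.continuous_gKer hcont z)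
    _ fun x => hc.exists_norm_gKer_le.choose_spec.2 x z

lemma IsRepFn.continuous_integral_gKer {c : ℝ → ℝ} (hc : IsRepFn c) (hcont : Continuous c)
    (ν : Measure ℝ) [IsFiniteMeasure ν] : Continuous fun z => ∫ x, gKer c x z ∂ν := by
  obtain ⟨K, hK, hle⟩ := hc.exists_norm_gKer_le
  refine continuous_iff_continuousAt.2 fun z₀ => ?_
  refine continuousAt_of_dominated
    (bound := fun _ => 2 + (|z₀| + 1) ^ 2 * Real.exp (|z₀| + 1) + K * (|z₀| + 1))
    (.of_forall fun z => (hc.continuous_gKer hcont z).aestronglyMeasurable) ?_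
    (integrable_const _) (.of_forall fun x => (continuous_gKer_right c x).continuousAt)
  have hev : ∀ᶠ z in 𝓝 z₀, |z| < |z₀| + 1 :=
    continuous_abs.continuousAt.eventually_lt_const (by linarith)
  filter_upwards [hev] with z hz
  refine .of_forall fun x => (hle x z).trans ?_
  rw [← sq_abs z]
  gcongr

/-- Convergence of the integral differences of real bounded continuous functions implies the
same for complex ones. -/
lemma tendsto_integral_sub_integral_complex {X ι : Type*} [TopologicalSpace X] [MeasurableSpace X]
    [OpensMeasurableSpace X] {l : Filter ι} {ζp ζm : ι → Measure X} {ξp ξm : Measure X}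
    [∀ i, IsFiniteMeasure (ζp i)] [∀ i, IsFiniteMeasure (ζm i)]
    [IsFiniteMeasure ξp] [IsFiniteMeasure ξm]
    (h : ∀ f : BoundedContinuousFunction X ℝ,
      Tendsto (fun i => (∫ x, f x ∂(ζp i)) - ∫ x, f x ∂(ζm i)) l
        (𝓝 ((∫ x, f x ∂ξp) - ∫ x, f x ∂ξm)))
    (f : BoundedContinuousFunction X ℂ) :
    Tendsto (fun i => (∫ x, f x ∂(ζp i)) - ∫ x, f x ∂(ζm i)) l
      (𝓝 ((∫ x, f x ∂ξp) - ∫ x, f x ∂ξm)) := by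
  have hre := h (f.comp _ reCLM.lipschitz)
  have him := h (f.comp _ imCLM.lipschitz)
  have hint (ν : Measure X) [IsFiniteMeasure ν] : ∫ x, f x ∂ν =
      ((∫ x, (f x).re ∂ν : ℝ) : ℂ) + ((∫ x, (f x).im ∂ν : ℝ) : ℂ) * I :=
    (integral_re_add_im (𝕜 := ℂ) (f.integrable ν)).symm
  have key := ((continuous_ofReal.tendsto _).comp hre).add
    (((continuous_ofReal.tendsto _).comp him).mul_const I)
  simp_rw [hint]
  convert key using 2
  · simp only [Function.comp_apply, BoundedContinuousFunction.comp_apply, reCLM_apply, imCLM_apply]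
    push_cast
    ring
  · simp only [BoundedContinuousFunction.comp_apply, reCLM_apply, imCLM_apply]
    push_cast
    ring

/-- if γ_n → γ and the signed measures ζ_n = ζp_n - ζm_n converge
weakly to ζ = ξp - ξm, then the quasi-infinitely divisible μ_n converge weakly
to a quasi-infinitely divisible μ with characteristic pair (ζ, γ)_c. -/
theorem stmt12 (c : ℝ → ℝ) (hc : IsRepFn c) (hcont : Continuous c)
    (μs : ℕ → Measure ℝ) (hprob : ∀ n, IsProbabilityMeasure (μs n))
    (ζp ζm : ℕ → Measure ℝ) (γs : ℕ → ℝ)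
    (hfin : ∀ n, IsFiniteMeasure (ζp n) ∧ IsFiniteMeasure (ζm n) ∧
      Measure.MutuallySingular (ζp n) (ζm n))
    (hrep : ∀ n, ∀ z : ℝ, charFn (μs n) z = Complex.exp (Complex.I * (γs n) * z
      + (∫ x, gKer c x z ∂(ζp n)) - ∫ x, gKer c x z ∂(ζm n)))
    (γ : ℝ) (hγ : Tendsto γs atTop (nhds γ))
    (ξp ξm : Measure ℝ) [IsFiniteMeasure ξp] [IsFiniteMeasure ξm]
    (hξ : Measure.MutuallySingular ξp ξm)
    (hweak : ∀ f : BoundedContinuousFunction ℝ ℝ,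
      Tendsto (fun n => (∫ x, f x ∂(ζp n)) - ∫ x, f x ∂(ζm n)) atTop
        (nhds ((∫ x, f x ∂ξp) - ∫ x, f x ∂ξm))) :
    ∃ μ : Measure ℝ, IsProbabilityMeasure μ ∧
      (∀ z : ℝ, charFn μ z = Complex.exp (Complex.I * γ * z
        + (∫ x, gKer c x z ∂ξp) - ∫ x, gKer c x z ∂ξm)) ∧
      ∀ f : BoundedContinuousFunction ℝ ℝ,
        Tendsto (fun n => ∫ x, f x ∂(μs n)) atTop (nhds (∫ x, f x ∂μ)) := by
  have : ∀ n, IsFiniteMeasure (ζp n) := fun n => (hfin n).1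
  have : ∀ n, IsFiniteMeasure (ζm n) := fun n => (hfin n).2.1
  set F : ℝ → ℂ := fun z => Complex.exp (Complex.I * γ * z
    + (∫ x, gKer c x z ∂ξp) - ∫ x, gKer c x z ∂ξm)
  have hF : Continuous F := by
    have hp := hc.continuous_integral_gKer hcont ξp
    have hm := hc.continuous_integral_gKer hcont ξm
    fun_prop
  let P : ℕ → ProbabilityMeasure ℝ := fun n => ⟨μs n, hprob n⟩
  have hlim (z : ℝ) : Tendsto (fun n => charFun (P n : Measure ℝ) z) atTop (𝓝 (F z)) := by
    have hγz : Tendsto (fun n => Complex.I * (γs n : ℂ) * z) atTop (𝓝 (Complex.I * γ * z)) :=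
      (((continuous_ofReal.tendsto γ).comp hγ).const_mul _).mul_const _
    have hg := tendsto_integral_sub_integral_complex hweak (gKerBCF hc hcont z)
    refine (((Complex.continuous_exp.tendsto _).comp (hγz.add hg)).congr fun n => ?_).trans_eq ?_
    · change _ = charFun (μs n) z
      rw [← charFn_eq_charFun, hrep, add_sub_assoc]
      rfl
    · simp only [F, add_sub_assoc]
      rfl
  obtain ⟨μ, hμ, hconv⟩ := exists_tendsto_of_tendsto_charFun hF.continuousAt hlim
  exact ⟨μ, μ.2, fun z => (charFn_eq_charFun _ z).trans (hμ z),
    ProbabilityMeasure.tendsto_iff_forall_integral_tendsto.1 hconv⟩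
end
end

section
/- Let μ be quasi-infinitely divisible with characteristic triplet (a, ν, γ)_c with respect to c(x) = x·1_{|x|≤1}, and suppose ∫_{|x|>1} |x| ν⁺(dx) < ∞. Then a random variable X with law μ has finite mean and E[X] = γ + ∫_{|x|>1} x ν(dx). -/
open MeasureTheory Complex Filter

noncomputable section

lemma lintegral_one_sub_cos_div_sq_le (x : ℝ) :
    ∫⁻ z in Set.Ioc (0 : ℝ) 1, ENNReal.ofReal ((1 - Real.cos (z * x)) / z ^ 2) ≤
      ENNReal.ofReal (5 / 2 * Real.pi * |x|) := by
  rcases eq_or_ne x 0 with rfl | hx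
  · simp
  have hint : Integrable fun z : ℝ => 5 / 2 * x ^ 2 * (1 + (z * x) ^ 2)⁻¹ :=
    (integrable_inv_one_add_sq.comp_mul_right' hx).const_mul _
  calc ∫⁻ z in Set.Ioc (0 : ℝ) 1, ENNReal.ofReal ((1 - Real.cos (z * x)) / z ^ 2)
      ≤ ∫⁻ z in Set.Ioc (0 : ℝ) 1, ENNReal.ofReal (5 / 2 * x ^ 2 * (1 + (z * x) ^ 2)⁻¹) := by
        refine setLIntegral_mono' measurableSet_Ioc fun z hz => ENNReal.ofReal_le_ofReal ?_
        have hz0 : 0 < z := hz.1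
        rw [← div_eq_mul_inv, div_le_div_iff₀ (by positivity) (by positivity)]
        have h1 := Real.one_sub_sq_div_two_le_cos (x := z * x)
        have h2 := Real.neg_one_le_cos (z * x)
        have h3 : 5 / 2 * x ^ 2 * z ^ 2 = 5 / 2 * (z * x) ^ 2 := by ring
        rw [h3]
        generalize Real.cos (z * x) = c at *
        generalize (z * x) = t at *
        rcases le_total (t ^ 2) 4 with h | h
        · nlinarith [sq_nonneg t]
        · nlinarith [sq_nonneg t]
    _ ≤ ∫⁻ z : ℝ, ENNReal.ofReal (5 / 2 * x ^ 2 * (1 + (z * x) ^ 2)⁻¹) :=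
        setLIntegral_le_lintegral _ _
    _ = ENNReal.ofReal (5 / 2 * Real.pi * |x|) := by
        rw [← ofReal_integral_eq_lintegral_ofReal hint (ae_of_all _ fun z => by positivity),
          integral_const_mul,
          Measure.integral_comp_mul_right (fun z : ℝ => (1 + z ^ 2)⁻¹) x,
          integral_univ_inv_one_add_sq, abs_inv, smul_eq_mul, ← sq_abs x]
        congr 1
        have : |x| ≠ 0 := abs_ne_zero.2 hx
        field_simp

lemma ofReal_abs_le_lintegral_one_sub_cos (x : ℝ) :
    ENNReal.ofReal |x| ≤ 1 + 8 *
      ∫⁻ z in Set.Ioc (0 : ℝ) 1, ENNReal.ofReal ((1 - Real.cos (z * x)) / z ^ 2) := by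
  rcases le_total |x| 1 with h | h
  · exact (ENNReal.ofReal_le_one.2 h).trans le_self_add
  have hx : 0 < |x| := by linarith
  have hsub : Set.Ioc (0 : ℝ) |x|⁻¹ ⊆ Set.Ioc 0 1 :=
    Set.Ioc_subset_Ioc_right (inv_le_one_of_one_le₀ h)
  have key : ENNReal.ofReal (|x| / 8) ≤
      ∫⁻ z in Set.Ioc (0 : ℝ) 1, ENNReal.ofReal ((1 - Real.cos (z * x)) / z ^ 2) := by
    calc ENNReal.ofReal (|x| / 8)
        = ∫⁻ z in Set.Ioc (0 : ℝ) |x|⁻¹, ENNReal.ofReal (x ^ 2 / 8) := by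
          rw [setLIntegral_const, Real.volume_Ioc, ← ENNReal.ofReal_mul (by positivity), ← sq_abs x]
          congr 1
          field_simp
          ring
      _ ≤ ∫⁻ z in Set.Ioc (0 : ℝ) |x|⁻¹,
            ENNReal.ofReal ((1 - Real.cos (z * x)) / z ^ 2) := by
          refine setLIntegral_mono' measurableSet_Ioc fun z hz => ENNReal.ofReal_le_ofReal ?_
          have hz0 : 0 < z := hz.1
          have ht : |z * x| ≤ 1 := by
            rw [abs_mul, abs_of_pos hz0]
            calc z * |x| ≤ |x|⁻¹ * |x| := by gcongr; exact hz.2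
              _ = 1 := inv_mul_cancel₀ hx.ne'
          have hpi := Real.pi_lt_four
          have hpi3 := Real.pi_gt_three
          have hc := Real.cos_le_one_sub_mul_cos_sq (ht.trans (by linarith) : |z * x| ≤ Real.pi)
          have h8 : 1 / 8 ≤ 2 / Real.pi ^ 2 := by
            rw [div_le_div_iff₀ (by norm_num) (by positivity)]
            nlinarith
          rw [le_div_iff₀ (by positivity)]
          nlinarith [sq_nonneg (z * x)]
      _ ≤ _ := lintegral_mono_set hsub
  calc ENNReal.ofReal |x| = 8 * ENNReal.ofReal (|x| / 8) := by
        rw [show (8 : ENNReal) = ENNReal.ofReal 8 by simp, ← ENNReal.ofReal_mul (by norm_num)]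
        congr 1
        ring
    _ ≤ 8 * _ := by gcongr
    _ ≤ _ := le_add_self

lemma integrable_one_sub_cos (τ : Measure ℝ) [IsFiniteMeasure τ] (z : ℝ) :
    Integrable (fun x => 1 - Real.cos (z * x)) τ := by
  refine Integrable.of_bound (C := 2) (by fun_prop) (ae_of_all _ fun x => ?_)
  rw [Real.norm_eq_abs, abs_le]
  constructor <;> linarith [Real.cos_le_one (z * x), Real.neg_one_le_cos (z * x)]

lemma lintegral_one_sub_cos_div_sq (τ : Measure ℝ) [IsFiniteMeasure τ] (z : ℝ) :
    ∫⁻ x, ENNReal.ofReal ((1 - Real.cos (z * x)) / z ^ 2) ∂τ =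
      ENNReal.ofReal ((∫ x, (1 - Real.cos (z * x)) ∂τ) / z ^ 2) := by
  rw [← integral_div, ofReal_integral_eq_lintegral_ofReal ((integrable_one_sub_cos τ z).div_const _)]
  exact ae_of_all _ fun x =>
    div_nonneg (by linarith [Real.cos_le_one (z * x)]) (sq_nonneg z)

/-- A comparison criterion for finiteness of the first absolute moment, in terms of the
behaviour near the origin of the real part of the characteristic function. -/
theorem integrable_id_of_integral_one_sub_cos_le {ρ σ : Measure ℝ} [IsFiniteMeasure ρ]
    [IsFiniteMeasure σ] (hσ : Integrable (fun x : ℝ => x) σ) {K Q : ℝ} (hK : 0 ≤ K)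
    (h : ∀ z ∈ Set.Ioc (0 : ℝ) 1, ∫ x, (1 - Real.cos (z * x)) ∂ρ ≤
      K * (∫ x, (1 - Real.cos (z * x)) ∂σ) + Q * z ^ 2) :
    Integrable (fun x : ℝ => x) ρ := by
  have hmeas : Measurable (Function.uncurry fun z x : ℝ =>
      ENNReal.ofReal ((1 - Real.cos (z * x)) / z ^ 2)) := by
    unfold Function.uncurry; fun_prop
  have swap (τ : Measure ℝ) [IsFiniteMeasure τ] :
      ∫⁻ z in Set.Ioc (0 : ℝ) 1, ∫⁻ x, ENNReal.ofReal ((1 - Real.cos (z * x)) / z ^ 2) ∂τ =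
      ∫⁻ x, (∫⁻ z in Set.Ioc (0 : ℝ) 1, ENNReal.ofReal ((1 - Real.cos (z * x)) / z ^ 2)) ∂τ :=
    lintegral_lintegral_swap hmeas.aemeasurable
  have hσ' : ∫⁻ z in Set.Ioc (0 : ℝ) 1,
      ∫⁻ x, ENNReal.ofReal ((1 - Real.cos (z * x)) / z ^ 2) ∂σ < ⊤ := by
    rw [swap]
    refine (lintegral_mono lintegral_one_sub_cos_div_sq_le).trans_lt ?_
    exact (hσ.abs.const_mul (5 / 2 * Real.pi)).lintegral_lt_top
  have hρ' : ∫⁻ z in Set.Ioc (0 : ℝ) 1,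
      ∫⁻ x, ENNReal.ofReal ((1 - Real.cos (z * x)) / z ^ 2) ∂ρ < ⊤ := by
    calc _ ≤ ∫⁻ z in Set.Ioc (0 : ℝ) 1, (ENNReal.ofReal K *
          ∫⁻ x, ENNReal.ofReal ((1 - Real.cos (z * x)) / z ^ 2) ∂σ + ENNReal.ofReal Q) := by
          refine setLIntegral_mono' measurableSet_Ioc fun z hz => ?_
          have hz0 : 0 < z := hz.1
          rw [lintegral_one_sub_cos_div_sq, lintegral_one_sub_cos_div_sq, ← ENNReal.ofReal_mul hK]
          refine le_trans (ENNReal.ofReal_le_ofReal ?_) ENNReal.ofReal_add_le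
          rw [div_le_iff₀ (by positivity)]
          refine (h z hz).trans_eq ?_
          field_simp
      _ < ⊤ := by
          rw [lintegral_add_right _ measurable_const, lintegral_const_mul' _ _ ENNReal.ofReal_ne_top]
          refine ENNReal.add_lt_top.2 ⟨ENNReal.mul_lt_top ENNReal.ofReal_lt_top hσ', ?_⟩
          simp
  refine ⟨by fun_prop, ?_⟩
  rw [hasFiniteIntegral_iff_norm]
  calc ∫⁻ x, ENNReal.ofReal ‖x‖ ∂ρ ≤ ∫⁻ x, (1 + 8 *
      ∫⁻ z in Set.Ioc (0 : ℝ) 1, ENNReal.ofReal ((1 - Real.cos (z * x)) / z ^ 2)) ∂ρ :=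
        lintegral_mono ofReal_abs_le_lintegral_one_sub_cos
    _ < ⊤ := by
        rw [lintegral_add_left measurable_const, lintegral_const_mul' _ _ (by simp), ← swap]
        refine ENNReal.add_lt_top.2 ⟨by simp, ENNReal.mul_lt_top (by simp) hρ'⟩

/-- The truncation function, equal to `x` for `|x| ≤ 1` and to `0` elsewhere. -/
def truncation (x : ℝ) : ℝ := if |x| ≤ 1 then x else 0

lemma measurable_truncation : Measurable truncation :=
  Measurable.ite (measurableSet_le (by fun_prop) measurable_const) measurable_id measurable_const

lemma measurableSet_lt_abs (R : ℝ) : MeasurableSet {x : ℝ | R < |x|} :=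
  measurableSet_lt measurable_const (by fun_prop)

lemma norm_exp_I_mul_mul (z x : ℝ) : ‖Complex.exp (Complex.I * z * x)‖ = 1 := by
  have := Complex.norm_exp_I_mul_ofReal (z * x)
  rwa [Complex.ofReal_mul, ← mul_assoc] at this

lemma norm_lkKernel_truncation_le {z : ℝ} (hz : |z| ≤ 1) (x : ℝ) :
    ‖Complex.exp (Complex.I * z * x) - 1 - Complex.I * z * truncation x‖ ≤
      2 * min 1 (x ^ 2) := by
  unfold truncation
  split_ifs with hx
  · have hn : ‖Complex.I * z * x‖ = |z| * |x| := by simp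
    have h1 : |z| * |x| ≤ |x| := mul_le_of_le_one_left (abs_nonneg x) hz
    have hx2 : x ^ 2 ≤ 1 := (sq_le_one_iff_abs_le_one x).2 hx
    refine (Complex.norm_exp_sub_one_sub_id_le (by rw [hn]; linarith)).trans ?_
    rw [min_eq_right hx2, hn]
    calc (|z| * |x|) ^ 2 ≤ |x| ^ 2 := by gcongr
      _ ≤ 2 * x ^ 2 := by rw [sq_abs]; nlinarith [sq_nonneg x]
  · have hx2 : 1 ≤ x ^ 2 := (one_le_sq_iff_one_le_abs x).2 (by linarith)
    rw [min_eq_left hx2]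
    simp only [Complex.ofReal_zero, mul_zero, sub_zero]
    refine (norm_sub_le _ _).trans ?_
    rw [norm_exp_I_mul_mul, norm_one]
    norm_num

lemma measurable_lkKernel {c : ℝ → ℝ} (hc : Measurable c) (z : ℝ) :
    Measurable fun x : ℝ => Complex.exp (Complex.I * z * x) - 1 - Complex.I * z * c x := by
  fun_prop

lemma lkKernel_re (c : ℝ → ℝ) (z x : ℝ) :
    (Complex.exp (Complex.I * z * x) - 1 - Complex.I * z * c x).re = -(1 - Real.cos (z * x)) := by
  have : Complex.I * z * x = ((z * x : ℝ) : ℂ) * Complex.I := by push_cast; ring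
  rw [this]
  simp [-Complex.ofReal_mul, Complex.exp_ofReal_mul_I_re]

lemma lkKernel_im (c : ℝ → ℝ) (z x : ℝ) :
    (Complex.exp (Complex.I * z * x) - 1 - Complex.I * z * c x).im =
      Real.sin (z * x) - z * c x := by
  have : Complex.I * z * x = ((z * x : ℝ) : ℂ) * Complex.I := by push_cast; ring
  rw [this]
  simp [-Complex.ofReal_mul, Complex.exp_ofReal_mul_I_im]

lemma min_one_sq_nonneg (x : ℝ) : 0 ≤ min 1 (x ^ 2) := le_min zero_le_one (sq_nonneg x)

lemma one_sub_cos_le_indicator_add {R z : ℝ} (hR : 1 ≤ R) (x : ℝ) :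
    1 - Real.cos (z * x) ≤ {x : ℝ | R < |x|}.indicator (fun x => 1 - Real.cos (z * x)) x +
      z ^ 2 * R ^ 2 * min 1 (x ^ 2) := by
  have hm := min_one_sq_nonneg x
  by_cases hx : R < |x|
  · rw [Set.indicator_of_mem (by exact hx)]
    nlinarith [mul_nonneg (mul_nonneg (sq_nonneg z) (sq_nonneg R)) hm]
  · rw [Set.indicator_of_notMem (by exact hx), zero_add]
    have hxR : x ^ 2 ≤ R ^ 2 := by rw [← sq_abs x]; gcongr; linarith
    have h1 : x ^ 2 ≤ R ^ 2 * min 1 (x ^ 2) := by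
      rcases min_cases 1 (x ^ 2) with ⟨h, _⟩ | ⟨h, _⟩ <;> rw [h] <;>
        nlinarith [mul_nonneg (sub_nonneg.2 (one_le_pow₀ (n := 2) hR)) (sq_nonneg x)]
    have h2 := Real.one_sub_sq_div_two_le_cos (x := z * x)
    nlinarith [mul_le_mul_of_nonneg_left h1 (sq_nonneg z), sq_nonneg (z * x)]

lemma abs_sin_sub_le_indicator_add {R z : ℝ} (hR : 1 ≤ R) (hz : |z| ≤ 1) (x : ℝ) :
    |Real.sin (z * x) - z * truncation x| ≤
      {x : ℝ | R < |x|}.indicator (fun x => |Real.sin (z * x)|) x +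
        |z| * R ^ 2 * min 1 (x ^ 2) := by
  have hm := min_one_sq_nonneg x
  have hK : 0 ≤ |z| * R ^ 2 * min 1 (x ^ 2) := by positivity
  by_cases hx : R < |x|
  · rw [Set.indicator_of_mem (by exact hx), truncation, if_neg (by linarith)]
    simpa using hK
  rw [Set.indicator_of_notMem (by exact hx), zero_add]
  unfold truncation
  split_ifs with hx1
  · have hx2 : x ^ 2 ≤ 1 := (sq_le_one_iff_abs_le_one x).2 hx1
    have hn : ‖Complex.I * z * x‖ = |z| * |x| := by simp
    have h1 : |z| * |x| ≤ 1 := mul_le_one₀ hz (abs_nonneg x) hx1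
    have h2 := Complex.norm_exp_sub_one_sub_id_le (x := Complex.I * z * x) (by rwa [hn])
    have h3 := (Complex.abs_im_le_norm _).trans h2
    rw [lkKernel_im (fun x => x), hn] at h3
    rw [min_eq_right hx2]
    refine h3.trans ?_
    calc (|z| * |x|) ^ 2 = |z| * 1 * x ^ 2 * |z| := by rw [← sq_abs x]; ring
      _ ≤ |z| * R ^ 2 * x ^ 2 * 1 := by gcongr; nlinarith
      _ = _ := mul_one _
  · have hx2 : 1 ≤ x ^ 2 := (one_le_sq_iff_one_le_abs x).2 (by linarith)
    rw [min_eq_left hx2, mul_zero, sub_zero, mul_one]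
    calc |Real.sin (z * x)| ≤ |z * x| := Real.abs_sin_le_abs
      _ = |z| * |x| := abs_mul _ _
      _ ≤ |z| * R ^ 2 := by gcongr; nlinarith

lemma integrable_min_one_sq {ν : Measure ℝ}
    (hν : ∫⁻ x, ENNReal.ofReal (min 1 (x ^ 2)) ∂ν < ⊤) :
    Integrable (fun x : ℝ => min 1 (x ^ 2)) ν := by
  refine ⟨by fun_prop, ?_⟩
  rw [hasFiniteIntegral_iff_norm]
  simpa only [Real.norm_of_nonneg (min_one_sq_nonneg _)] using hν

lemma isFiniteMeasure_restrict_lt_abs {ν : Measure ℝ}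
    (hν : Integrable (fun x : ℝ => min 1 (x ^ 2)) ν) {R : ℝ} (hR : 1 ≤ R) :
    IsFiniteMeasure (ν.restrict {x : ℝ | R < |x|}) := by
  refine ⟨?_⟩
  rw [Measure.restrict_apply_univ]
  refine (measure_mono fun x hx => ?_).trans_lt (hν.measure_ge_lt_top zero_lt_one)
  have hx' : R < |x| := hx
  exact le_min le_rfl ((one_le_sq_iff_one_le_abs x).2 (by linarith))

lemma integrable_lkKernel {ν : Measure ℝ}
    (hν : Integrable (fun x : ℝ => min 1 (x ^ 2)) ν) {z : ℝ} (hz : |z| ≤ 1) :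
    Integrable (fun x : ℝ =>
      Complex.exp (Complex.I * z * x) - 1 - Complex.I * z * truncation x) ν :=
  (hν.const_mul 2).mono' (measurable_lkKernel measurable_truncation z).aestronglyMeasurable
    (ae_of_all _ (norm_lkKernel_truncation_le hz))

lemma integrable_one_sub_cos_of_levy {ν : Measure ℝ}
    (hν : Integrable (fun x : ℝ => min 1 (x ^ 2)) ν) {z : ℝ} (hz : |z| ≤ 1) :
    Integrable (fun x : ℝ => 1 - Real.cos (z * x)) ν := by
  refine (integrable_lkKernel hν hz).re.neg.congr (ae_of_all _ fun x => ?_)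
  have := lkKernel_re truncation z x
  simp only [Pi.neg_apply, RCLike.re_to_complex, this, neg_neg]

lemma lkInt_re {ν : Measure ℝ}
    (hν : Integrable (fun x : ℝ => min 1 (x ^ 2)) ν) {z : ℝ} (hz : |z| ≤ 1) :
    (lkInt truncation ν z).re = -∫ x, (1 - Real.cos (z * x)) ∂ν := by
  rw [← integral_neg]
  simp_rw [← lkKernel_re truncation]
  exact (integral_re (integrable_lkKernel hν hz)).symm

lemma lkInt_im {ν : Measure ℝ}
    (hν : Integrable (fun x : ℝ => min 1 (x ^ 2)) ν) {z : ℝ} (hz : |z| ≤ 1) :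
    (lkInt truncation ν z).im = ∫ x, (Real.sin (z * x) - z * truncation x) ∂ν := by
  simp_rw [← lkKernel_im truncation]
  exact (integral_im (integrable_lkKernel hν hz)).symm

lemma integral_one_sub_cos_le {ν : Measure ℝ}
    (hν : Integrable (fun x : ℝ => min 1 (x ^ 2)) ν) {R z : ℝ} (hR : 1 ≤ R) (hz : |z| ≤ 1) :
    ∫ x, (1 - Real.cos (z * x)) ∂ν ≤ (∫ x in {x : ℝ | R < |x|}, (1 - Real.cos (z * x)) ∂ν) +
      z ^ 2 * (R ^ 2 * ∫ x, min 1 (x ^ 2) ∂ν) := by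
  have hi := (integrable_one_sub_cos_of_levy hν hz)
  rw [← integral_indicator (measurableSet_lt_abs R), ← mul_assoc, ← integral_const_mul,
    ← integral_add (hi.indicator (measurableSet_lt_abs R)) (hν.const_mul _)]
  exact integral_mono hi ((hi.indicator (measurableSet_lt_abs R)).add (hν.const_mul _))
    (one_sub_cos_le_indicator_add hR)

lemma setIntegral_one_sub_cos_le {ν : Measure ℝ}
    (hν : Integrable (fun x : ℝ => min 1 (x ^ 2)) ν) {R z : ℝ} (hz : |z| ≤ 1) :
    ∫ x in {x : ℝ | R < |x|}, (1 - Real.cos (z * x)) ∂ν ≤ ∫ x, (1 - Real.cos (z * x)) ∂ν :=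
  setIntegral_le_integral (integrable_one_sub_cos_of_levy hν hz)
    (ae_of_all _ fun _ => sub_nonneg.2 (Real.cos_le_one _))

lemma integrableOn_abs_sin {ν : Measure ℝ}
    (hν : Integrable (fun x : ℝ => min 1 (x ^ 2)) ν) {R z : ℝ} (hR : 1 ≤ R) :
    IntegrableOn (fun x : ℝ => |Real.sin (z * x)|) {x : ℝ | R < |x|} ν := by
  have := isFiniteMeasure_restrict_lt_abs hν hR
  exact Integrable.of_bound (C := 1) (by fun_prop)
    (ae_of_all _ fun x => by simpa using Real.abs_sin_le_one (z * x))

lemma abs_lkInt_im_le {ν : Measure ℝ}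
    (hν : Integrable (fun x : ℝ => min 1 (x ^ 2)) ν) {R z : ℝ} (hR : 1 ≤ R) (hz : |z| ≤ 1) :
    |(lkInt truncation ν z).im| ≤ (∫ x in {x : ℝ | R < |x|}, |Real.sin (z * x)| ∂ν) +
      |z| * (R ^ 2 * ∫ x, min 1 (x ^ 2) ∂ν) := by
  have hi : Integrable (fun x => Real.sin (z * x) - z * truncation x) ν := by
    refine (integrable_lkKernel hν hz).im.congr (ae_of_all _ fun x => ?_)
    exact lkKernel_im truncation z x
  have hs : Integrable ({x : ℝ | R < |x|}.indicator fun x => |Real.sin (z * x)|) ν :=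
    (integrableOn_abs_sin hν hR).integrable_indicator (measurableSet_lt_abs R)
  rw [lkInt_im hν hz, ← integral_indicator (measurableSet_lt_abs R), ← mul_assoc,
    ← integral_const_mul, ← integral_add hs (hν.const_mul _)]
  exact abs_integral_le_integral_abs.trans (integral_mono hi.abs (hs.add (hν.const_mul _))
    (abs_sin_sub_le_indicator_add hR hz))

/-- A Lévy measure charges the complement of a large interval only little. -/
lemma exists_measureReal_lt_abs_le {ν : Measure ℝ}
    (hν : Integrable (fun x : ℝ => min 1 (x ^ 2)) ν) :
    ∃ R : ℝ, 1 ≤ R ∧ ν.real {x : ℝ | R < |x|} ≤ 1 / 4 := by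
  have hlim : Tendsto (fun n : ℕ => ν {x : ℝ | (n : ℝ) + 1 < |x|}) atTop
      (nhds (ν (⋂ n : ℕ, {x : ℝ | (n : ℝ) + 1 < |x|}))) := by
    refine tendsto_measure_iInter_atTop (fun n => (measurableSet_lt_abs _).nullMeasurableSet)
      (fun m n hmn x hx => ?_) ⟨0, ?_⟩
    · have hx' : (n : ℝ) + 1 < |x| := hx
      have : (m : ℝ) ≤ n := by exact_mod_cast hmn
      exact (by linarith : (m : ℝ) + 1 < |x|)
    · have := isFiniteMeasure_restrict_lt_abs hν (R := (0 : ℕ) + 1) (by simp)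
      simpa using (measure_lt_top (ν.restrict {x : ℝ | ((0 : ℕ) : ℝ) + 1 < |x|}) Set.univ).ne
  have hempty : (⋂ n : ℕ, {x : ℝ | (n : ℝ) + 1 < |x|}) = ∅ := by
    refine Set.eq_empty_of_forall_notMem fun x hx => ?_
    obtain ⟨n, hn⟩ := exists_nat_gt |x|
    have : (n : ℝ) + 1 < |x| := Set.mem_iInter.1 hx n
    linarith
  rw [hempty, measure_empty] at hlim
  obtain ⟨n, hn⟩ := (hlim.eventually
    (gt_mem_nhds (ENNReal.ofReal_pos.2 (by norm_num : (0 : ℝ) < 1 / 4)))).exists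
  exact ⟨n + 1, by simp, ENNReal.toReal_le_of_le_ofReal (by norm_num) hn.le⟩

lemma sq_setIntegral_abs_sin_le {ν : Measure ℝ}
    (hν : Integrable (fun x : ℝ => min 1 (x ^ 2)) ν) {R z : ℝ} (hR : 1 ≤ R)
    (hm : ν.real {x : ℝ | R < |x|} ≤ 1 / 4) :
    (∫ x in {x : ℝ | R < |x|}, |Real.sin (z * x)| ∂ν) ^ 2 ≤
      (∫ x in {x : ℝ | R < |x|}, (1 - Real.cos (z * x)) ∂ν) / 2 := by
  have := isFiniteMeasure_restrict_lt_abs hν hR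
  set D := ∫ x in {x : ℝ | R < |x|}, |Real.sin (z * x)| ∂ν
  have hB := integrable_one_sub_cos (ν.restrict {x : ℝ | R < |x|}) z
  have hS : Integrable (fun x => |Real.sin (z * x)|) (ν.restrict {x : ℝ | R < |x|}) :=
    integrableOn_abs_sin hν hR
  have key : 0 ≤ ∫ x in {x : ℝ | R < |x|},
      (2 * (1 - Real.cos (z * x)) - 8 * D * |Real.sin (z * x)| + 16 * D ^ 2) ∂ν := by
    refine integral_nonneg fun x => ?_
    change (0 : ℝ) ≤ _
    have h1 := Real.sin_sq_add_cos_sq (z * x)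
    have h2 := Real.cos_le_one (z * x)
    have h3 := sq_abs (Real.sin (z * x))
    nlinarith [sq_nonneg (|Real.sin (z * x)| - 4 * D), sq_nonneg (1 - Real.cos (z * x))]
  have hBS : Integrable (fun x => 2 * (1 - Real.cos (z * x)) - 8 * D * |Real.sin (z * x)|)
      (ν.restrict {x : ℝ | R < |x|}) := (hB.const_mul _).sub (hS.const_mul _)
  rw [integral_add hBS (integrable_const _), integral_sub (hB.const_mul _) (hS.const_mul _),
    integral_const_mul, integral_const_mul,
    integral_const, smul_eq_mul, measureReal_restrict_apply_univ] at key
  change 0 ≤ _ - 8 * D * D + _ at key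
  nlinarith [mul_le_mul_of_nonneg_right hm (sq_nonneg D)]

lemma integrableOn_id_of_lt_abs {ν : Measure ℝ}
    (hν : Integrable (fun x : ℝ => min 1 (x ^ 2)) ν) {R : ℝ}
    (h : IntegrableOn (fun x : ℝ => x) {x : ℝ | R < |x|} ν) :
    IntegrableOn (fun x : ℝ => x) {x : ℝ | 1 < |x|} ν := by
  have := isFiniteMeasure_restrict_lt_abs hν le_rfl
  have hR : IntegrableOn (fun _ : ℝ => R) {x : ℝ | 1 < |x|} ν := integrable_const R
  refine ((h.integrable_indicator (measurableSet_lt_abs R)).abs.integrableOn.add hR.abs).mono'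
    (by fun_prop) (ae_of_all _ fun x => ?_)
  by_cases hx : R < |x|
  · simp [Set.indicator_of_mem (show x ∈ {x : ℝ | R < |x|} from hx)]
  · simpa [Set.indicator_of_notMem (show x ∉ {x : ℝ | R < |x|} from hx)] using
      (not_lt.1 hx).trans (le_abs_self R)

lemma hasDerivAt_lkInt {c : ℝ → ℝ} (hc : Measurable c) {ν : Measure ℝ} {b : ℝ → ℝ}
    (hb : Integrable b ν)
    (hbound : ∀ z : ℝ, |z| ≤ 1 → ∀ x : ℝ, ‖x * Complex.exp (Complex.I * z * x) - c x‖ ≤ b x) :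
    HasDerivAt (lkInt c ν) (Complex.I * ((∫ x, (x - c x) ∂ν : ℝ) : ℂ)) 0 := by
  have key := (hasDerivAt_integral_of_dominated_loc_of_deriv_le (𝕜 := ℝ) (μ := ν)
    (F := fun (z : ℝ) (x : ℝ) => Complex.exp (Complex.I * z * x) - 1 - Complex.I * z * c x)
    (F' := fun (z : ℝ) (x : ℝ) =>
      Complex.I * (x * Complex.exp (Complex.I * z * x) - c x))
    (x₀ := 0) (bound := b) (Metric.closedBall_mem_nhds 0 one_pos)
    (.of_forall fun z => (measurable_lkKernel hc z).aestronglyMeasurable)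
    (by simp) (by fun_prop) (ae_of_all _ fun x z hz => ?_) hb
    (ae_of_all _ fun x z _ => ?_)).2
  · convert! key using 1
    rw [← integral_complex_ofReal, ← integral_const_mul]
    simp
  · rw [norm_mul, Complex.norm_I, one_mul]
    exact hbound z (by simpa using hz) x
  · have h1 : HasDerivAt (fun z : ℝ => (z : ℂ)) 1 z := Complex.ofRealCLM.hasDerivAt
    have h2 : HasDerivAt (fun z : ℝ => Complex.I * (z : ℂ)) Complex.I z := by
      simpa using h1.const_mul Complex.I
    refine (((h2.mul_const (x : ℂ)).cexp.sub_const 1).sub (h2.mul_const (c x : ℂ))).congr_deriv ?_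
    ring

lemma hasDerivAt_lkInt_truncation {ν : Measure ℝ}
    (hν : Integrable (fun x : ℝ => min 1 (x ^ 2)) ν)
    (hmom : IntegrableOn (fun x : ℝ => x) {x : ℝ | 1 < |x|} ν) :
    HasDerivAt (lkInt truncation ν)
      (Complex.I * ((∫ x in {x : ℝ | 1 < |x|}, x ∂ν : ℝ) : ℂ)) 0 := by
  have hS := measurableSet_lt_abs 1
  have hI : ∫ x in {x : ℝ | 1 < |x|}, x ∂ν = ∫ x, (x - truncation x) ∂ν := by
    rw [← integral_indicator hS]
    congr 1 with x
    by_cases hx : 1 < |x|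
    · simp [truncation, hx, not_le.2 hx]
    · simp [truncation, hx, not_lt.1 hx]
  rw [hI]
  refine hasDerivAt_lkInt measurable_truncation
    (hν.add (hmom.integrable_indicator hS).abs) fun z hz x => ?_
  have hm := min_one_sq_nonneg x
  by_cases hx : 1 < |x|
  · simp only [truncation, not_le.2 hx, if_false, Pi.add_apply, Complex.ofReal_zero, sub_zero,
      norm_mul, norm_exp_I_mul_mul, mul_one, Complex.norm_real, Real.norm_eq_abs,
      Set.indicator_of_mem (show x ∈ {x : ℝ | 1 < |x|} from hx)]
    linarith
  · have hx1 := not_lt.1 hx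
    have h := Real.norm_exp_I_mul_ofReal_sub_one_le (x := z * x)
    rw [Complex.ofReal_mul, ← mul_assoc, norm_mul, Real.norm_eq_abs, Real.norm_eq_abs] at h
    simp only [truncation, hx1, if_true, Pi.add_apply, abs_zero, add_zero,
      Set.indicator_of_notMem (show x ∉ {x : ℝ | 1 < |x|} from hx)]
    rw [min_eq_right ((sq_le_one_iff_abs_le_one x).2 hx1)]
    calc ‖(x : ℂ) * Complex.exp (Complex.I * z * x) - x‖
        = |x| * ‖Complex.exp (Complex.I * z * x) - 1‖ := by
          rw [← Real.norm_eq_abs, ← Complex.norm_real, ← norm_mul, mul_sub, mul_one]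
      _ ≤ |x| * (1 * |x|) := by gcongr; exact h.trans (by gcongr)
      _ = x ^ 2 := by rw [one_mul, ← sq, sq_abs]

lemma integrable_exp_I_mul_mul (μ : Measure ℝ) [IsFiniteMeasure μ] (z : ℝ) :
    Integrable (fun x : ℝ => Complex.exp (Complex.I * z * x)) μ :=
  Integrable.of_bound (C := 1) (by fun_prop) (ae_of_all _ fun x => (norm_exp_I_mul_mul z x).le)

lemma norm_charFn_le_one (μ : Measure ℝ) [IsProbabilityMeasure μ] (z : ℝ) :
    ‖charFn μ z‖ ≤ 1 := by
  refine (norm_integral_le_integral_norm _).trans_eq ?_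
  simp [norm_exp_I_mul_mul]

lemma lkInt_zero_eq_charFn_sub_one (μ : Measure ℝ) [IsProbabilityMeasure μ] (z : ℝ) :
    lkInt (fun _ => 0) μ z = charFn μ z - 1 := by
  simp only [lkInt, charFn, Complex.ofReal_zero, mul_zero, sub_zero]
  rw [integral_sub (integrable_exp_I_mul_mul μ z) (integrable_const _)]
  simp

lemma one_sub_charFn_re (μ : Measure ℝ) [IsProbabilityMeasure μ] (z : ℝ) :
    ∫ x, (1 - Real.cos (z * x)) ∂μ = 1 - (charFn μ z).re := by
  have hi : Integrable (fun x : ℝ =>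
      Complex.exp (Complex.I * z * x) - 1 - Complex.I * z * ((0 : ℝ) : ℂ)) μ := by
    simp only [Complex.ofReal_zero, mul_zero, sub_zero]
    exact (integrable_exp_I_mul_mul μ z).sub (integrable_const 1)
  have h : (lkInt (fun _ => 0) μ z).re = -∫ x, (1 - Real.cos (z * x)) ∂μ := by
    rw [← integral_neg]
    simp_rw [← lkKernel_re (fun _ => 0)]
    exact (integral_re hi).symm
  rw [lkInt_zero_eq_charFn_sub_one, Complex.sub_re, Complex.one_re] at h
  linarith

lemma hasDerivAt_charFn (μ : Measure ℝ) [IsProbabilityMeasure μ]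
    (hμ : Integrable (fun x : ℝ => x) μ) :
    HasDerivAt (charFn μ) (Complex.I * ((∫ x, x ∂μ : ℝ) : ℂ)) 0 := by
  have h := (hasDerivAt_lkInt (c := fun _ => 0) measurable_const hμ.abs
    fun z _ x => by simp [norm_exp_I_mul_mul]).add_const 1
  simp only [lkInt_zero_eq_charFn_sub_one, sub_zero, sub_add_cancel] at h
  exact h

lemma one_sub_re_exp_le {w : ℂ} (hw : ‖Complex.exp w‖ ≤ 1) :
    1 - (Complex.exp w).re ≤ -w.re + w.im ^ 2 / 2 := by
  rw [Complex.norm_exp] at hw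
  rw [Complex.exp_re]
  nlinarith [Real.add_one_le_exp w.re, Real.one_sub_sq_div_two_le_cos (x := w.im),
    Real.cos_le_one w.im, Real.exp_pos w.re]

/-- Near the origin, the real part of the characteristic function controls the large jumps of the
negative part of the quasi-Lévy measure, up to those of the positive part and a quadratic term. -/
lemma exists_one_sub_cos_bound {μ : Measure ℝ} [IsProbabilityMeasure μ] {a γ : ℝ}
    {νp νm : Measure ℝ} (hp : Integrable (fun x : ℝ => min 1 (x ^ 2)) νp)
    (hm : Integrable (fun x : ℝ => min 1 (x ^ 2)) νm)
    (hchar : ∀ z : ℝ, charFn μ z = Complex.exp (Complex.I * γ * z - a * z ^ 2 / 2 +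
      lkInt truncation νp z - lkInt truncation νm z))
    {R : ℝ} (hR : 1 ≤ R) (hmR : νm.real {x : ℝ | R < |x|} ≤ 1 / 4)
    (hmom : IntegrableOn (fun x : ℝ => x) {x : ℝ | R < |x|} νp) :
    ∃ Q : ℝ, ∀ z ∈ Set.Ioc (0 : ℝ) 1,
      (∫ x, (1 - Real.cos (z * x)) ∂μ) +
          (∫ x in {x : ℝ | R < |x|}, (1 - Real.cos (z * x)) ∂νm) / 2 ≤
        (∫ x in {x : ℝ | R < |x|}, (1 - Real.cos (z * x)) ∂νp) + Q * z ^ 2 := by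
  set Kp := R ^ 2 * ∫ x, min 1 (x ^ 2) ∂νp
  set Km := R ^ 2 * ∫ x, min 1 (x ^ 2) ∂νm
  set M := ∫ x in {x : ℝ | R < |x|}, |x| ∂νp
  refine ⟨Kp + |a| / 2 + (|γ| + M + Kp + Km) ^ 2, fun z hz => ?_⟩
  have hz0 : 0 < z := hz.1
  have hz1 : |z| ≤ 1 := by rw [abs_of_pos hz0]; exact hz.2
  have hcos := one_sub_re_exp_le ((hchar z).symm ▸ norm_charFn_le_one μ z)
  rw [← hchar z, ← one_sub_charFn_re] at hcos
  set w := Complex.I * γ * z - a * z ^ 2 / 2 + lkInt truncation νp z - lkInt truncation νm z with hw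
  have hre : w.re = -(a * z ^ 2 / 2) + (lkInt truncation νp z).re -
      (lkInt truncation νm z).re := by
    rw [hw, show Complex.I * γ * z - a * z ^ 2 / 2 =
      ((γ * z : ℝ) : ℂ) * Complex.I - ((a * z ^ 2 / 2 : ℝ) : ℂ) by push_cast; ring]
    simp [-Complex.ofReal_mul, -Complex.ofReal_div]
  have him : w.im = γ * z + (lkInt truncation νp z).im - (lkInt truncation νm z).im := by
    rw [hw, show Complex.I * γ * z - a * z ^ 2 / 2 =
      ((γ * z : ℝ) : ℂ) * Complex.I - ((a * z ^ 2 / 2 : ℝ) : ℂ) by push_cast; ring]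
    simp [-Complex.ofReal_mul, -Complex.ofReal_div]
  have hP := integral_one_sub_cos_le hp hR hz1
  have hN := setIntegral_one_sub_cos_le hm (R := R) hz1
  have hPi := abs_lkInt_im_le hp hR hz1
  have hNi := abs_lkInt_im_le hm hR hz1
  have hD := sq_setIntegral_abs_sin_le hm (z := z) hR hmR
  have hMz : ∫ x in {x : ℝ | R < |x|}, |Real.sin (z * x)| ∂νp ≤ z * M := by
    rw [← integral_const_mul]
    refine integral_mono (integrableOn_abs_sin hp hR) (hmom.abs.const_mul z) fun x => ?_
    simpa [abs_mul, abs_of_pos hz0] using Real.abs_sin_le_abs (x := z * x)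
  rw [lkInt_re hp hz1, lkInt_re hm hz1] at hre
  rw [abs_of_pos hz0] at hPi hNi
  set D := ∫ x in {x : ℝ | R < |x|}, |Real.sin (z * x)| ∂νm
  have hw_im : |w.im| ≤ (|γ| + M + Kp + Km) * z + D := by
    rw [him]
    have h1 := abs_sub (γ * z + (lkInt truncation νp z).im) (lkInt truncation νm z).im
    have h2 := abs_add_le (γ * z) (lkInt truncation νp z).im
    rw [abs_mul, abs_of_pos hz0] at h2
    linarith
  have hsq : w.im ^ 2 ≤ ((|γ| + M + Kp + Km) * z + D) ^ 2 := by
    rw [← sq_abs]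
    gcongr
  have ha : a * z ^ 2 ≤ |a| * z ^ 2 := by gcongr; exact le_abs_self a
  nlinarith [sq_nonneg ((|γ| + M + Kp + Km) * z - D)]

/-- if ∫_{|x|>1}|x| dν⁺ < ∞ then μ has finite mean
E X = γ + ∫_{|x|>1} x dν. -/
theorem stmt15 (μ : Measure ℝ) [IsProbabilityMeasure μ] (a γ : ℝ) (νp νm : Measure ℝ)
    (htrip : HasTriplet (fun x => if |x| ≤ 1 then x else 0) μ a νp νm γ)
    (hmom : (∫⁻ x in {x : ℝ | 1 < |x|}, ENNReal.ofReal |x| ∂νp) < ⊤) :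
    Integrable (fun x => x) μ ∧
      ∫ x, x ∂μ = γ + ((∫ x in {x : ℝ | 1 < |x|}, x ∂νp) -
        ∫ x in {x : ℝ | 1 < |x|}, x ∂νm) := by
  obtain ⟨-, -, -, hfin, hchar⟩ := htrip
  rw [lintegral_add_measure, ENNReal.add_lt_top] at hfin
  have hp := integrable_min_one_sq hfin.1
  have hm := integrable_min_one_sq hfin.2
  change ∀ z : ℝ, charFn μ z = Complex.exp (Complex.I * γ * z - a * z ^ 2 / 2 +
    lkInt truncation νp z - lkInt truncation νm z) at hchar
  have hmom_p : IntegrableOn (fun x : ℝ => x) {x : ℝ | 1 < |x|} νp :=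
    ⟨by fun_prop, by rwa [hasFiniteIntegral_iff_norm]⟩
  obtain ⟨R, hR, hmR⟩ := exists_measureReal_lt_abs_le hm
  have hmom_R : IntegrableOn (fun x : ℝ => x) {x : ℝ | R < |x|} νp :=
    hmom_p.mono_set fun x hx => lt_of_le_of_lt hR hx
  obtain ⟨Q, hQ⟩ := exists_one_sub_cos_bound hp hm hchar hR hmR hmom_R
  have := isFiniteMeasure_restrict_lt_abs hp hR
  have := isFiniteMeasure_restrict_lt_abs hm hR
  have hnonneg (τ : Measure ℝ) (z : ℝ) : 0 ≤ ∫ x, (1 - Real.cos (z * x)) ∂τ :=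
    integral_nonneg fun x => sub_nonneg.2 (Real.cos_le_one _)
  have hμ : Integrable (fun x : ℝ => x) μ :=
    integrable_id_of_integral_one_sub_cos_le hmom_R (K := 1) (Q := Q) zero_le_one fun z hz => by
      linarith [hQ z hz, hnonneg (νm.restrict {x : ℝ | R < |x|}) z]
  have hmom_m : IntegrableOn (fun x : ℝ => x) {x : ℝ | 1 < |x|} νm := by
    refine integrableOn_id_of_lt_abs hm (R := R) (integrable_id_of_integral_one_sub_cos_le hmom_R
      (K := 2) (Q := 2 * Q) zero_le_two fun z hz => ?_)
    linarith [hQ z hz, hnonneg μ z]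
  refine ⟨hμ, ?_⟩
  have hid : HasDerivAt (fun z : ℝ => (z : ℂ)) 1 0 := Complex.ofRealCLM.hasDerivAt
  have hexp := (((((hid.const_mul (Complex.I * γ)).sub
    (((hid.pow 2).const_mul (a : ℂ)).div_const 2)).add (hasDerivAt_lkInt_truncation hp hmom_p)).sub
    (hasDerivAt_lkInt_truncation hm hmom_m))).cexp
  have hderiv := (hasDerivAt_charFn μ hμ).unique (hexp.congr_of_eventuallyEq (.of_forall hchar))
  have hzero (ν : Measure ℝ) : lkInt truncation ν 0 = 0 := by simp [lkInt]
  simp only [Pi.pow_apply, Pi.sub_apply, Pi.add_apply, ofReal_zero, mul_zero, ne_eq,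
    OfNat.ofNat_ne_zero, not_false_eq_true, zero_pow, zero_div, sub_self, hzero, add_zero, exp_zero,
    mul_one, Nat.cast_ofNat, Nat.add_one_sub_one, pow_one, sub_zero, ← mul_add, ← mul_sub, one_mul,
    mul_eq_mul_left_iff, I_ne_zero, or_false] at hderiv
  rw [← add_sub_assoc]
  exact_mod_cast hderiv
end
end
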